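/- arXiv:1703.01215 — 2 statements merged into one kernel-verified Lean document; each statement's English description precedes it below -/
import Mathlib

section
/- Let p be a prime with p ≡ 1 (mod 4). Then ∑_{k=0}^{p−1} ((1/2)_k/k!)² · (−1)^k ≡ p² · ∑_{k=0}^{p−1} (k!/(3/2)_k)² · (−1)^k (mod p²), i.e. viewing both sums in ℚ_p, the p-adic norm of their difference (after multiplying the second sum by p²) is at most p^{−2}. (This confirms the conjecture of Deines, Fuselier, Long, Swisher and Tu: ₂F₁[1/2, 1/2; 1 | −1]_{p−1} ≡ p² · ₃F₂[1, 1, 1; 3/2, 3/2 | −1]_{p−1} (mod p²).) -/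
open scoped BigOperators

/-- The Pochhammer symbol `(x)_k = x(x+1)⋯(x+k-1)` in `ℚ_[p]`. -/
noncomputable def poch (p : ℕ) [Fact p.Prime] (x : ℚ_[p]) (k : ℕ) : ℚ_[p] :=
  (ascPochhammer ℚ_[p] k).eval x

/-- The least non-negative residue `⟨α⟩_p ∈ {0,…,p-1}` of `α ∈ ℤ_[p]` modulo `p`. -/
noncomputable def res (p : ℕ) [Fact p.Prime] (α : ℤ_[p]) : ℕ :=
  (PadicInt.toZMod α).val

section Helpers

variable {p : ℕ} [Fact p.Prime]

theorem padic_norm_natCast_eq_one {n : ℕ} (h : ¬ p ∣ n) : ‖(n : ℚ_[p])‖ = 1 := by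
  rw [Padic.norm_natCast_eq_one_iff]
  exact (Nat.Prime.coprime_iff_not_dvd Fact.out).2 h

theorem padic_norm_natCast_eq_one_of_lt {n : ℕ} (h0 : 0 < n) (h : n < p) :
    ‖(n : ℚ_[p])‖ = 1 :=
  padic_norm_natCast_eq_one (Nat.not_dvd_of_pos_of_lt h0 h)

theorem padic_norm_natCast_le_one (n : ℕ) : ‖(n : ℚ_[p])‖ ≤ 1 := by
  simpa using Padic.norm_int_le_one (p := p) (n : ℤ)

theorem norm_eq_of_unit_mul_eq {d x y : ℚ_[p]} (hd : ‖d‖ = 1) (h : d * x = y) : ‖x‖ = ‖y‖ := by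
  rw [← h, norm_mul, hd, one_mul]

theorem padic_norm_add_le {x y : ℚ_[p]} {r : ℝ} (hx : ‖x‖ ≤ r) (hy : ‖y‖ ≤ r) : ‖x + y‖ ≤ r :=
  (Padic.nonarchimedean x y).trans (max_le hx hy)

theorem padic_norm_sub_le {x y : ℚ_[p]} {r : ℝ} (hx : ‖x‖ ≤ r) (hy : ‖y‖ ≤ r) : ‖x - y‖ ≤ r := by
  rw [sub_eq_add_neg]
  exact padic_norm_add_le hx (by rwa [norm_neg])

theorem padic_norm_mul_le {x y : ℚ_[p]} {r : ℝ} (hx : ‖x‖ ≤ r) (hy : ‖y‖ ≤ 1) :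
    ‖x * y‖ ≤ r := by
  rw [norm_mul]
  exact (mul_le_of_le_one_right (norm_nonneg _) hy).trans hx

theorem padic_norm_sum_le {s : Finset ℕ} {f : ℕ → ℚ_[p]} {r : ℝ} (hr : 0 ≤ r)
    (h : ∀ i ∈ s, ‖f i‖ ≤ r) : ‖∑ i ∈ s, f i‖ ≤ r :=
  IsUltrametricDist.norm_sum_le_of_forall_le_of_nonneg hr h

theorem padic_norm_p_le_one : ‖(p : ℚ_[p])‖ ≤ 1 := padic_norm_natCast_le_one p

theorem padic_norm_sq_le {x : ℚ_[p]} (h : ‖x‖ ≤ ‖(p : ℚ_[p])‖) :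
    ‖x ^ 2‖ ≤ ‖(p : ℚ_[p])‖ ^ 2 := by
  rw [norm_pow]
  gcongr

/-- The coefficient `(1/2)_k / k!`. -/
noncomputable def halfCoeff (p : ℕ) [Fact p.Prime] (k : ℕ) : ℚ_[p] :=
  poch p (1 / 2) k / (Nat.factorial k : ℚ_[p])

/-- The coefficient `k! / (3/2)_k`. -/
noncomputable def dualCoeff (p : ℕ) [Fact p.Prime] (k : ℕ) : ℚ_[p] :=
  (Nat.factorial k : ℚ_[p]) / poch p (3 / 2) k

theorem poch_zero (x : ℚ_[p]) : poch p x 0 = 1 := by simp [poch]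

theorem poch_succ (x : ℚ_[p]) (k : ℕ) : poch p x (k + 1) = poch p x k * (x + k) := by
  simp [poch, ascPochhammer_succ_eval]

theorem halfCoeff_zero : halfCoeff p 0 = 1 := by simp [halfCoeff, poch_zero]

theorem dualCoeff_zero : dualCoeff p 0 = 1 := by simp [dualCoeff, poch_zero]

theorem halfCoeff_succ (k : ℕ) :
    ((2 * k + 2 : ℕ) : ℚ_[p]) * halfCoeff p (k + 1) = ((2 * k + 1 : ℕ) : ℚ_[p]) * halfCoeff p k := by
  have h1 : ((k : ℚ_[p]) + 1) ≠ 0 := by exact_mod_cast Nat.succ_ne_zero k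
  have h2 : (Nat.factorial k : ℚ_[p]) ≠ 0 := by exact_mod_cast Nat.factorial_ne_zero k
  simp only [halfCoeff, poch_succ, Nat.factorial_succ]
  push_cast
  field_simp
  ring

theorem dualCoeff_succ (k : ℕ) :
    ((2 * k + 3 : ℕ) : ℚ_[p]) * dualCoeff p (k + 1) = ((2 * k + 2 : ℕ) : ℚ_[p]) * dualCoeff p k := by
  have h1 : (3 + 2 * (k : ℚ_[p])) ≠ 0 := by
    rw [add_comm]
    exact_mod_cast Nat.succ_ne_zero (2 * k + 2)
  simp only [dualCoeff, poch_succ, Nat.factorial_succ]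
  by_cases h2 : poch p (3 / 2) k = 0
  · simp [h2]
  · push_cast
    field_simp
    ring

theorem dualCoeff_mul_halfCoeff (k : ℕ) :
    ((2 * k + 1 : ℕ) : ℚ_[p]) * (dualCoeff p k * halfCoeff p k) = 1 := by
  induction k with
  | zero => simp [halfCoeff_zero, dualCoeff_zero]
  | succ k ih =>
    have h2 : ((2 * k + 2 : ℕ) : ℚ_[p]) ≠ 0 := by exact_mod_cast Nat.succ_ne_zero (2 * k + 1)
    have h3 := halfCoeff_succ (p := p) k
    have h4 := dualCoeff_succ (p := p) k
    apply mul_left_cancel₀ h2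
    rw [show 2 * (k + 1) + 1 = 2 * k + 3 by ring]
    linear_combination (((2 * k + 2 : ℕ) : ℚ_[p]) * halfCoeff p (k + 1)) * h4 +
      (((2 * k + 2 : ℕ) : ℚ_[p]) * dualCoeff p k) * h3 + (((2 * k + 2 : ℕ) : ℚ_[p])) * ih

variable {m : ℕ}

theorem norm_halfCoeff_eq_one (hm : p = 2 * m + 1) {k : ℕ} (hk : k ≤ m) :
    ‖halfCoeff p k‖ = 1 := by
  induction k with
  | zero => simp [halfCoeff_zero]
  | succ k ih =>
    rw [norm_eq_of_unit_mul_eq (padic_norm_natCast_eq_one_of_lt (by lia) (by lia))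
      (halfCoeff_succ k), norm_mul, ih (by lia),
      padic_norm_natCast_eq_one_of_lt (by lia) (by lia), one_mul]

theorem norm_halfCoeff_le (hm : p = 2 * m + 1) (j : ℕ) (hj : m + 1 + j < p) :
    ‖halfCoeff p (m + 1 + j)‖ ≤ ‖(p : ℚ_[p])‖ := by
  have hd : ∀ k, k + 1 < p → ‖((2 * k + 2 : ℕ) : ℚ_[p])‖ = 1 := fun k hk => by
    rw [show 2 * k + 2 = 2 * (k + 1) by ring, Nat.cast_mul, norm_mul,
      padic_norm_natCast_eq_one_of_lt (n := 2) (by lia) (by lia),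
      padic_norm_natCast_eq_one_of_lt (by lia) hk, one_mul]
  induction j with
  | zero =>
    rw [add_zero, norm_eq_of_unit_mul_eq (hd m (by lia)) (halfCoeff_succ m), norm_mul,
      norm_halfCoeff_eq_one hm le_rfl, ← hm, mul_one]
  | succ j ih =>
    rw [← add_assoc, norm_eq_of_unit_mul_eq (hd _ (by lia)) (halfCoeff_succ _), mul_comm]
    exact padic_norm_mul_le (ih (by lia)) (padic_norm_natCast_le_one _)

theorem norm_dualCoeff_eq_one (hm : p = 2 * m + 1) {k : ℕ} (hk : k < m) :
    ‖dualCoeff p k‖ = 1 := by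
  have h := congrArg norm (dualCoeff_mul_halfCoeff (p := p) k)
  rwa [norm_mul, norm_mul, norm_halfCoeff_eq_one hm hk.le,
    padic_norm_natCast_eq_one_of_lt (by lia) (by lia), norm_one, one_mul, mul_one] at h

/-- `(1/2)_k / k! ≡ (-1)^k * C((p-1)/2, k)` modulo `p`. -/
theorem norm_halfCoeff_sub_choose_le (hm : p = 2 * m + 1) {k : ℕ} (hk : k ≤ m) :
    ‖halfCoeff p k - (-1) ^ k * (m.choose k : ℚ_[p])‖ ≤ ‖(p : ℚ_[p])‖ := by
  induction k with
  | zero => simp [halfCoeff_zero]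
  | succ k ih =>
    have hc : (m.choose (k + 1) : ℚ_[p]) * (k + 1) = m.choose k * (m - k) := by
      rw [← Nat.cast_sub (by lia)]
      exact_mod_cast Nat.choose_succ_right_eq m k
    have hp : (p : ℚ_[p]) = 2 * m + 1 := by exact_mod_cast congrArg (Nat.cast (R := ℚ_[p])) hm
    have key : ((2 * k + 2 : ℕ) : ℚ_[p]) *
        (halfCoeff p (k + 1) - (-1) ^ (k + 1) * (m.choose (k + 1) : ℚ_[p])) =
        (halfCoeff p k - (-1) ^ k * (m.choose k : ℚ_[p])) * ((2 * k + 1 : ℕ) : ℚ_[p]) +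
          p * ((-1) ^ k * (m.choose k : ℚ_[p])) := by
      have h1 := halfCoeff_succ (p := p) k
      rw [hp]
      push_cast at h1 ⊢
      rw [pow_succ]
      linear_combination h1 + 2 * (-1) ^ k * hc
    rw [norm_eq_of_unit_mul_eq (padic_norm_natCast_eq_one_of_lt (by lia) (by lia)) key]
    refine padic_norm_add_le (padic_norm_mul_le (ih (by lia)) (padic_norm_natCast_le_one _))
      (padic_norm_mul_le le_rfl ?_)
    rw [norm_mul, norm_pow, norm_neg, norm_one, one_pow, one_mul]
    exact padic_norm_natCast_le_one _

theorem norm_halfCoeff_sub_reflect_le (hm : p = 2 * m + 1) (he : Even m) {j : ℕ} (hj : j ≤ m) :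
    ‖halfCoeff p j - halfCoeff p (m - j)‖ ≤ ‖(p : ℚ_[p])‖ := by
  have h1 := norm_halfCoeff_sub_choose_le hm hj
  have h2 := norm_halfCoeff_sub_choose_le hm (Nat.sub_le m j)
  have hs : ((-1) ^ (m - j) : ℚ_[p]) = (-1) ^ j :=
    neg_one_pow_congr (by rw [Nat.even_sub hj]; simp [he])
  rw [Nat.choose_symm hj, hs] at h2
  simpa using padic_norm_sub_le h1 h2

theorem dualCoeff_mul_halfCoeff_reflect_succ (hm : p = 2 * m + 1) {j : ℕ} (hj : j < m) :
    (((p + (2 * j + 2) : ℕ) : ℚ_[p]) * ((p - (2 * j + 2) : ℕ) : ℚ_[p])) *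
        (dualCoeff p (m + (j + 1)) * halfCoeff p (m - (j + 1))) =
      (((p : ℚ_[p]) ^ 2 - (2 * j + 1) ^ 2)) * (dualCoeff p (m + j) * halfCoeff p (m - j)) := by
  obtain ⟨i, rfl⟩ : ∃ i, m = i + 1 + j := ⟨m - 1 - j, by lia⟩
  have h1 := halfCoeff_succ (p := p) i
  have h2 := dualCoeff_succ (p := p) (i + 1 + j + j)
  have hp : (p : ℚ_[p]) = 2 * (i + 1 + j) + 1 := by
    exact_mod_cast congrArg (Nat.cast (R := ℚ_[p])) hm
  rw [Nat.add_sub_cancel, show i + 1 + j - (j + 1) = i by lia,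
    show p - (2 * j + 2) = 2 * i + 1 by lia, ← add_assoc (i + 1 + j)]
  push_cast at h1 h2 ⊢
  rw [hp]
  linear_combination ((2 * i + 1) * halfCoeff p i) * h2 -
    ((2 * (i + 1 + j + j) + 2) * dualCoeff p (i + 1 + j + j)) * h1

/-- Modulo `p ^ 2`, the product `p * dualCoeff p ((p-1)/2 + j) * halfCoeff p ((p-1)/2 - j)` is
the product of `(p/2 + 1/2)_j / (p/2 + 1)_j` and its conjugate under `p ↦ -p`, so `p` may be
replaced by `0` in it. -/
theorem norm_dualCoeff_mul_halfCoeff_sub_le (hm : p = 2 * m + 1) {j : ℕ} (hj : j ≤ m) :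
    ‖p * (dualCoeff p (m + j) * halfCoeff p (m - j)) - halfCoeff p j ^ 2‖ ≤
      ‖(p : ℚ_[p])‖ ^ 2 := by
  induction j with
  | zero =>
    have h := dualCoeff_mul_halfCoeff (p := p) m
    rw [← hm] at h
    simp [h, halfCoeff_zero]
  | succ j ih =>
    specialize ih (by lia)
    have hj' : ‖halfCoeff p j ^ 2‖ ≤ 1 := by
      simp [norm_halfCoeff_eq_one hm (show j ≤ m by lia)]
    have hP := padic_norm_add_le (ih.trans (pow_le_one₀ (norm_nonneg _) padic_norm_p_le_one)) hj'
    rw [sub_add_cancel] at hP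
    have key : (((p + (2 * j + 2) : ℕ) : ℚ_[p]) * ((p - (2 * j + 2) : ℕ) : ℚ_[p])) *
        (p * (dualCoeff p (m + (j + 1)) * halfCoeff p (m - (j + 1))) - halfCoeff p (j + 1) ^ 2) =
        p ^ 2 * (p * (dualCoeff p (m + j) * halfCoeff p (m - j)) - halfCoeff p (j + 1) ^ 2) -
        (p * (dualCoeff p (m + j) * halfCoeff p (m - j)) - halfCoeff p j ^ 2) *
          ((2 * j + 1 : ℕ) : ℚ_[p]) ^ 2 := by
      have h1 := halfCoeff_succ (p := p) j
      have h2 := dualCoeff_mul_halfCoeff_reflect_succ hm (show j < m by lia)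
      rw [Nat.cast_sub (by lia)] at h2 ⊢
      push_cast at h1 h2 ⊢
      linear_combination p * h2 +
        ((2 * j + 2) * halfCoeff p (j + 1) + (2 * j + 1) * halfCoeff p j) * h1
    have hu : ‖((p + (2 * j + 2) : ℕ) : ℚ_[p]) * ((p - (2 * j + 2) : ℕ) : ℚ_[p])‖ = 1 := by
      rw [norm_mul, padic_norm_natCast_eq_one_of_lt (n := p - (2 * j + 2)) (by lia) (by lia),
        padic_norm_natCast_eq_one, one_mul]
      rw [Nat.dvd_add_right dvd_rfl]
      exact Nat.not_dvd_of_pos_of_lt (by lia) (by lia)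
    rw [norm_eq_of_unit_mul_eq hu key]
    refine padic_norm_sub_le (padic_norm_mul_le (norm_pow _ _).le (padic_norm_sub_le hP ?_))
      (padic_norm_mul_le ih ?_)
    · simp [norm_halfCoeff_eq_one hm hj]
    · rw [norm_pow]
      exact pow_le_one₀ (norm_nonneg _) (padic_norm_natCast_le_one _)

/-- If `u ≡ v (mod p)` are units, `P v ≡ u²` and `Q u ≡ v² (mod p²)`, then
`u² + v² ≡ P² + Q² (mod p²)`. -/
theorem norm_sq_add_sq_sub_le {u v P Q : ℚ_[p]} (hu : ‖u‖ = 1) (hv : ‖v‖ = 1)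
    (huv : ‖u - v‖ ≤ ‖(p : ℚ_[p])‖) (hP : ‖P * v - u ^ 2‖ ≤ ‖(p : ℚ_[p])‖ ^ 2)
    (hQ : ‖Q * u - v ^ 2‖ ≤ ‖(p : ℚ_[p])‖ ^ 2) :
    ‖(u ^ 2 - P ^ 2) + (v ^ 2 - Q ^ 2)‖ ≤ ‖(p : ℚ_[p])‖ ^ 2 := by
  have hp1 : ‖(p : ℚ_[p])‖ ^ 2 ≤ 1 := pow_le_one₀ (norm_nonneg _) padic_norm_p_le_one
  have hu2 : ‖u ^ 2‖ = 1 := by simp [hu]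
  have hv2 : ‖v ^ 2‖ = 1 := by simp [hv]
  have hPv : ‖P * v + u ^ 2‖ ≤ 1 := by
    have := padic_norm_add_le (hP.trans hp1) (padic_norm_add_le hu2.le hu2.le)
    rwa [show P * v - u ^ 2 + (u ^ 2 + u ^ 2) = P * v + u ^ 2 by ring] at this
  have hQu : ‖Q * u + v ^ 2‖ ≤ 1 := by
    have := padic_norm_add_le (hQ.trans hp1) (padic_norm_add_le hv2.le hv2.le)
    rwa [show Q * u - v ^ 2 + (v ^ 2 + v ^ 2) = Q * u + v ^ 2 by ring] at this
  have key : (u ^ 2 * v ^ 2) * ((u ^ 2 - P ^ 2) + (v ^ 2 - Q ^ 2)) =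
      -((u - v) ^ 2 * ((u + v) ^ 2 * (u ^ 2 + v ^ 2))) -
        (P * v - u ^ 2) * ((P * v + u ^ 2) * u ^ 2) -
        (Q * u - v ^ 2) * ((Q * u + v ^ 2) * v ^ 2) := by ring
  rw [norm_eq_of_unit_mul_eq (by rw [norm_mul, hu2, hv2, one_mul]) key]
  refine padic_norm_sub_le (padic_norm_sub_le ?_
    (padic_norm_mul_le hP (padic_norm_mul_le hPv hu2.le)))
    (padic_norm_mul_le hQ (padic_norm_mul_le hQu hv2.le))
  rw [norm_neg]
  refine padic_norm_mul_le (padic_norm_sq_le huv)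
    (padic_norm_mul_le ?_ (padic_norm_add_le hu2.le hv2.le))
  rw [norm_pow]
  exact pow_le_one₀ (norm_nonneg _) (padic_norm_add_le hu.le hv.le)

theorem norm_middle_sum_le (hm : p = 2 * m + 1) (he : Even m) :
    ‖∑ j ∈ Finset.range (m + 1),
      (halfCoeff p j ^ 2 - (p * dualCoeff p (m + j)) ^ 2) * (-1) ^ j‖ ≤ ‖(p : ℚ_[p])‖ ^ 2 := by
  set D : ℕ → ℚ_[p] := fun j => (halfCoeff p j ^ 2 - (p * dualCoeff p (m + j)) ^ 2) * (-1) ^ j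
    with hD
  have h2 : ‖((2 : ℕ) : ℚ_[p])‖ = 1 :=
    padic_norm_natCast_eq_one_of_lt (by lia) (by have := (Fact.out : p.Prime).two_le; lia)
  have hsum : ((2 : ℕ) : ℚ_[p]) * ∑ j ∈ Finset.range (m + 1), D j =
      ∑ j ∈ Finset.range (m + 1), (D j + D (m - j)) := by
    have := Finset.sum_range_reflect D (m + 1)
    simp only [Nat.add_sub_cancel] at this
    rw [Finset.sum_add_distrib, this]
    push_cast
    ring
  rw [norm_eq_of_unit_mul_eq h2 hsum]
  refine padic_norm_sum_le (by positivity) fun j hj => ?_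
  have hj : j ≤ m := by simpa [Nat.lt_succ_iff] using hj
  have hs : ((-1) ^ (m - j) : ℚ_[p]) = (-1) ^ j :=
    neg_one_pow_congr (by rw [Nat.even_sub hj]; simp [he])
  have hQ := norm_dualCoeff_mul_halfCoeff_sub_le hm (Nat.sub_le m j)
  rw [Nat.sub_sub_self hj, ← mul_assoc] at hQ
  have hP := norm_dualCoeff_mul_halfCoeff_sub_le hm hj
  rw [← mul_assoc] at hP
  simp only [hD, hs, ← add_mul]
  exact padic_norm_mul_le (norm_sq_add_sq_sub_le (norm_halfCoeff_eq_one hm hj)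
    (norm_halfCoeff_eq_one hm (Nat.sub_le m j)) (norm_halfCoeff_sub_reflect_le hm he hj) hP hQ)
    (by simp)

end Helpers

/-- The conjecture of Deines, Fuselier, Long, Swisher and Tu:
`₂F₁[1/2,1/2;1|−1]_{p−1} ≡ p² · ₃F₂[1,1,1;3/2,3/2|−1]_{p−1} (mod p²)`
for primes `p ≡ 1 (mod 4)`. -/
theorem padic_DFLST_conjecture
    (p : ℕ) [Fact p.Prime] (hp : p % 4 = 1) :
    ‖(∑ k ∈ Finset.range p,
        (poch p ((1 : ℚ_[p]) / 2) k / (Nat.factorial k : ℚ_[p])) ^ 2 * (-1 : ℚ_[p]) ^ k)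
      - (p : ℚ_[p]) ^ 2 *
          ∑ k ∈ Finset.range p,
            ((Nat.factorial k : ℚ_[p]) / poch p ((3 : ℚ_[p]) / 2) k) ^ 2 * (-1 : ℚ_[p]) ^ k‖
      ≤ (p : ℝ) ^ (-2 : ℤ) := by
  obtain ⟨n, hn⟩ : ∃ n, p = 2 * (2 * n) + 1 := ⟨p / 4, by lia⟩
  obtain ⟨m, hm, he⟩ : ∃ m, p = 2 * m + 1 ∧ Even m := ⟨2 * n, hn, even_two_mul n⟩
  change ‖(∑ k ∈ Finset.range p, halfCoeff p k ^ 2 * (-1) ^ k) -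
    (p : ℚ_[p]) ^ 2 * ∑ k ∈ Finset.range p, dualCoeff p k ^ 2 * (-1) ^ k‖ ≤ _
  have hr : (p : ℝ) ^ (-2 : ℤ) = ‖(p : ℚ_[p])‖ ^ 2 := by
    rw [Padic.norm_p, inv_pow, zpow_neg]
    rfl
  have hA : ∑ k ∈ Finset.range p, halfCoeff p k ^ 2 * (-1) ^ k =
      ∑ k ∈ Finset.range (m + 1), halfCoeff p k ^ 2 * (-1) ^ k +
      ∑ j ∈ Finset.range m, halfCoeff p (m + 1 + j) ^ 2 * (-1) ^ (m + 1 + j) := by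
    rw [← Finset.sum_range_add, show m + 1 + m = p by lia]
  have hB : ∑ k ∈ Finset.range p, dualCoeff p k ^ 2 * (-1) ^ k =
      ∑ k ∈ Finset.range m, dualCoeff p k ^ 2 * (-1) ^ k +
      ∑ j ∈ Finset.range (m + 1), dualCoeff p (m + j) ^ 2 * (-1) ^ j := by
    have h := Finset.sum_range_add (fun k => dualCoeff p k ^ 2 * (-1) ^ k) m (m + 1)
    rw [show m + (m + 1) = p by lia] at h
    simpa only [pow_add (-1 : ℚ_[p]) m, he.neg_one_pow, one_mul] using h
  have hsplit : (∑ k ∈ Finset.range p, halfCoeff p k ^ 2 * (-1) ^ k) -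
      (p : ℚ_[p]) ^ 2 * ∑ k ∈ Finset.range p, dualCoeff p k ^ 2 * (-1) ^ k =
      ∑ j ∈ Finset.range (m + 1),
        (halfCoeff p j ^ 2 - (p * dualCoeff p (m + j)) ^ 2) * (-1) ^ j +
      ∑ j ∈ Finset.range m, halfCoeff p (m + 1 + j) ^ 2 * (-1) ^ (m + 1 + j) -
      (p : ℚ_[p]) ^ 2 * ∑ k ∈ Finset.range m, dualCoeff p k ^ 2 * (-1) ^ k := by
    simp only [hA, hB, sub_mul, mul_pow, Finset.sum_sub_distrib, mul_assoc, ← Finset.mul_sum]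
    ring
  rw [hsplit, hr]
  refine padic_norm_sub_le (padic_norm_add_le (norm_middle_sum_le hm he) ?_)
    (padic_norm_mul_le (norm_pow _ _).le ?_)
  · refine padic_norm_sum_le (by positivity) fun j hj => ?_
    have hj : j < m := Finset.mem_range.1 hj
    exact padic_norm_mul_le (padic_norm_sq_le (norm_halfCoeff_le hm j (by lia))) (by simp)
  · refine padic_norm_sum_le zero_le_one fun j hj => ?_
    simp [norm_dualCoeff_eq_one hm (Finset.mem_range.1 hj)]
end

section
/- Let p be a prime with p ≡ 1 (mod 3), and write p = a² + 3b² with integers a, b such that a ≡ 1 (mod 3). Then ∑_{k=0}^{p−1} binom(2k,k)·binom(4k,2k)/48^k ≡ 2a − p/(2a) (mod p²), i.e. in ℚ_p the p-adic norm of ∑_{k=0}^{p−1} binom(2k,k)·binom(4k,2k)/48^k − 2a + p/(2a) is at most p^{−2}. (This confirms the case p ≡ 1 (mod 3) of a conjecture of Z.-W. Sun.) -/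
open scoped BigOperators

section

open Finset

/-- The `k`-th term of the hypergeometric series
`₂F₁(-x/2, (1-x)/2; (2-2x)/3; 4/3)`. -/
def hyperTerm {K : Type*} [Field K] (x : K) (k : ℕ) : K :=
  (∏ i ∈ range (2 * k), (x - i)) / (k.factorial * ∏ j ∈ range k, (3 * j + 2 - 2 * x))

lemma sum_hyperTerm_recurrence {K : Type*} [Field K] [CharZero K] (x : K) (n : ℕ)
    (hx : ∀ j < n + 1, (3 * j + 2 - 2 * x : K) ≠ 0 ∧ (3 * j - 4 - 2 * x : K) ≠ 0) :
    ∑ k ∈ range (n + 2), ((4 * x + 2) * hyperTerm (x + 3) k + (x + 1) * hyperTerm x k) =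
      (x + 1) * (5 * x + 11 - 8 * (n + 2)) * (∏ i ∈ range (2 * n + 1), (x - i)) /
        ((n + 1).factorial * ∏ j ∈ range (n + 1), (3 * j + 2 - 2 * x)) := by
  induction n with
  | zero =>
    obtain ⟨h1, h2⟩ := hx 0 (by simp)
    simp only [Nat.cast_zero, mul_zero, zero_add, zero_sub] at h1 h2
    have h3 : (2 - 2 * (x + 3) : K) ≠ 0 := by intro h; apply h2; linear_combination h
    have h4 : (1 - x : K) ≠ 0 := by intro h; apply h1; linear_combination 2 * h
    have h5 : (-2 - x : K) ≠ 0 := by intro h; apply h2; linear_combination 2 * h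
    have h6 : (1 - (x + 3) : K) ≠ 0 := by intro h; apply h2; linear_combination 2 * h
    simp [sum_range_succ, hyperTerm, prod_range_succ]
    field_simp
    ring
  | succ n ih =>
    rw [sum_range_succ, ih fun j hj => hx j (by lia)]
    obtain ⟨h0, h0'⟩ := hx 0 (by simp)
    obtain ⟨h1, h1'⟩ := hx 1 (by simp)
    obtain ⟨ha, -⟩ := hx n (by simp)
    obtain ⟨hb, -⟩ := hx (n + 1) (by simp)
    have hE : ∏ j ∈ range n, (3 * j + 2 - 2 * x : K) ≠ 0 :=
      prod_ne_zero_iff.2 fun j hj => (hx j (by simp at hj; lia)).1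
    have hf : ((n + 1).factorial : K) ≠ 0 := by exact_mod_cast Nat.factorial_ne_zero _
    have hn : ((n : K) + 2) ≠ 0 := by exact_mod_cast Nat.succ_ne_zero (n + 1)
    have hD : ∏ j ∈ range (n + 2), (3 * j + 2 - 2 * (x + 3) : K) =
        (∏ j ∈ range n, (3 * j + 2 - 2 * x : K)) * (-1 - 2 * x) * (2 * (-2 - x)) := by
      rw [prod_range_succ', prod_range_succ']
      congr 1
      · congr 1
        · refine prod_congr rfl fun j _ => ?_
          push_cast; ring
        · push_cast; ring
      · push_cast; ring
    have hA : ∏ i ∈ range (2 * (n + 2)), (x + 3 - i : K) =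
        (∏ i ∈ range (2 * n + 1), (x - i : K)) * (x + 1) * (x + 2) * (x + 3) := by
      rw [show 2 * (n + 2) = 2 * n + 1 + 1 + 1 + 1 by ring, prod_range_succ', prod_range_succ',
        prod_range_succ']
      congr 1
      · congr 1
        · congr 1
          · refine prod_congr rfl fun j _ => ?_
            push_cast; ring
          · push_cast; ring
        · push_cast; ring
      · push_cast; ring
    have h4 : (-1 - x * 2 : K) ≠ 0 := by
      intro h; apply h1'; push_cast; linear_combination h
    have h5 : (-2 - x : K) ≠ 0 := by
      intro h; apply h0'; push_cast; linear_combination 2 * h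
    have ha' : (n * 3 + 2 - x * 2 : K) ≠ 0 := by
      intro h; apply ha; linear_combination h
    have hb' : (3 * (n + 1) + 2 - x * 2 : K) ≠ 0 := by
      intro h; apply hb; push_cast; linear_combination h
    simp only [hyperTerm]
    rw [show n + 1 + 1 = n + 2 by ring, hD, hA, show 2 * (n + 2) = 2 * n + 1 + 1 + 1 + 1 by ring,
      show 2 * (n + 1) + 1 = 2 * n + 1 + 1 + 1 by ring, Nat.factorial_succ (n + 1)]
    generalize (n + 1).factorial = f at *
    simp only [prod_range_succ _ (2 * n + 1 + 1 + 1), prod_range_succ _ (2 * n + 1 + 1),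
      prod_range_succ _ (2 * n + 1), prod_range_succ _ (n + 1), prod_range_succ _ n]
    generalize ∏ j ∈ range n, (3 * j + 2 - 2 * x : K) = E at *
    generalize ∏ i ∈ range (2 * n + 1), (x - i : K) = X at *
    push_cast
    rw [show ((n : K) + 1 + 1) = n + 2 by ring]
    field_simp
    ring

lemma hyperTerm_natCast_eq_zero {K : Type*} [Field K] {N k : ℕ} (h : N < 2 * k) :
    hyperTerm (N : K) k = 0 := by
  rw [hyperTerm, prod_eq_zero (mem_range.2 h) (sub_self _), zero_div]

lemma sum_hyperTerm_eq_of_le {K : Type*} [Field K] {N n n' : ℕ} (h : N < 2 * n) (hn : n ≤ n') :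
    ∑ k ∈ range n', hyperTerm (N : K) k = ∑ k ∈ range n, hyperTerm (N : K) k := by
  symm
  refine sum_subset (range_mono hn) fun k _ hk => hyperTerm_natCast_eq_zero ?_
  simp at hk
  lia

lemma sum_hyperTerm_add_three {K : Type*} [Field K] [CharZero K] {N n : ℕ}
    (hN : ∀ j, 2 * j ≤ N + 1 → 3 * j + 2 ≠ 2 * N ∧ 3 * j ≠ 2 * N + 4) (hn : N + 3 < 2 * n) :
    ∑ k ∈ range n, hyperTerm ((N + 3 : ℕ) : K) k =
      -((N + 1) / (2 * (2 * N + 1))) * ∑ k ∈ range n, hyperTerm (N : K) k := by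
  have hD : ∀ j < (N + 1) / 2 + 1,
      (3 * j + 2 - 2 * N : K) ≠ 0 ∧ (3 * j - 4 - 2 * N : K) ≠ 0 := by
    intro j hj
    obtain ⟨h1, h2⟩ := hN j (by lia)
    refine ⟨fun h => h1 ?_, fun h => h2 ?_⟩
    · have : (3 * j + 2 : K) = 2 * N := by linear_combination h
      exact_mod_cast this
    · have : (3 * j : K) = 2 * N + 4 := by linear_combination h
      exact_mod_cast this
  have key := sum_hyperTerm_recurrence (N : K) ((N + 1) / 2) hD
  rw [prod_eq_zero (i := N) (by simp; lia) (sub_self _), mul_zero, zero_div, sum_add_distrib,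
    ← mul_sum, ← mul_sum, show (N : K) + 3 = ((N + 3 : ℕ) : K) by push_cast; ring,
    ← sum_hyperTerm_eq_of_le (n := (N + 1) / 2 + 2) (n' := n) (by lia) (by lia),
    ← sum_hyperTerm_eq_of_le (n := (N + 1) / 2 + 2) (n' := n) (by lia) (by lia)] at key
  have h2 : (N * 2 + 1 : K) ≠ 0 := by exact_mod_cast (N * 2).succ_ne_zero
  field_simp
  linear_combination key

lemma sum_hyperTerm_three_mul {K : Type*} [Field K] [CharZero K] {m n : ℕ} (hn : 3 * m < 2 * n) :
    ∑ k ∈ range n, hyperTerm ((3 * m : ℕ) : K) k =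
      ∏ i ∈ range m, -((3 * i + 1 : K) / (2 * (6 * i + 1))) := by
  induction m with
  | zero =>
    rw [sum_hyperTerm_eq_of_le (n := 1) (by lia) (by lia)]
    simp [hyperTerm]
  | succ m ih =>
    rw [show 3 * (m + 1) = 3 * m + 3 by ring, sum_hyperTerm_add_three (by lia) (by lia),
      ih (by lia), prod_range_succ, mul_comm]
    push_cast
    ring_nf

lemma sum_hyperTerm_three_mul_add_one {K : Type*} [Field K] [CharZero K] {m n : ℕ} (hm : 3 ≤ m)
    (hn : 3 * m + 1 < 2 * n) :
    ∑ k ∈ range n, hyperTerm ((3 * m + 1 : ℕ) : K) k =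
      ∏ i ∈ range m, -((3 * i + 2 : K) / (6 * (2 * i + 1))) := by
  induction m, hm using Nat.le_induction with
  | base =>
    rw [sum_hyperTerm_eq_of_le (n := 6) (by lia) (by lia)]
    simp [hyperTerm, sum_range_succ, prod_range_succ, Nat.factorial]
    norm_num
  | succ m hm ih =>
    rw [show 3 * (m + 1) + 1 = 3 * m + 1 + 3 by ring, sum_hyperTerm_add_three (by lia) (by lia),
      ih (by lia), prod_range_succ, mul_comm]
    push_cast
    ring_nf

section ZModSq

variable {p : ℕ} [hp : Fact p.Prime]

lemma isUnit_intCast_zmod_sq {n : ℤ} (hn : ¬ (p : ℤ) ∣ n) : IsUnit (n : ZMod (p ^ 2)) := by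
  rw [ZMod.coe_int_isUnit_iff_isCoprime]
  push_cast
  exact ((Nat.prime_iff_prime_int.1 hp.out).coprime_iff_not_dvd.2 hn).pow_left

lemma isUnit_natCast_zmod_sq {n : ℕ} (hn : ¬ p ∣ n) : IsUnit (n : ZMod (p ^ 2)) := by
  exact_mod_cast isUnit_intCast_zmod_sq (n := n) (by exact_mod_cast hn)

lemma isUnit_natCast_zmod_sq_of_lt {n : ℕ} (hn : n ≠ 0) (hnp : n < p) :
    IsUnit (n : ZMod (p ^ 2)) :=
  isUnit_natCast_zmod_sq fun h => absurd (Nat.le_of_dvd (by lia) h) (by lia)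

lemma isUnit_factorial_zmod_sq {n : ℕ} (hnp : n < p) : IsUnit (n.factorial : ZMod (p ^ 2)) :=
  isUnit_natCast_zmod_sq fun h => absurd (hp.out.dvd_factorial.1 h) (by lia)

omit hp in
lemma natCast_self_mul_self_zmod_sq : (p : ZMod (p ^ 2)) * p = 0 := by
  rw [← Nat.cast_mul, ← sq, ZMod.natCast_self]

/-- A finite sum of fractions with denominators prime to `p` is a `p`-adic integer, and its
reduction modulo `p ^ 2` can be computed termwise. -/
lemma exists_padicInt_eq_sum_div {ι : Type*} (s : Finset ι) (A D : ι → ℤ)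
    (hD : ∀ i ∈ s, ¬ (p : ℤ) ∣ D i) :
    ∃ z : ℤ_[p], (z : ℚ_[p]) = ∑ i ∈ s, (A i : ℚ_[p]) / D i ∧
      PadicInt.toZModPow 2 z = ∑ i ∈ s, (A i : ZMod (p ^ 2)) * (D i : ZMod (p ^ 2))⁻¹ := by
  classical
  induction s using Finset.induction_on with
  | empty => exact ⟨0, by simp, by simp⟩
  | insert i s hi ih =>
    obtain ⟨z, hz, hz'⟩ := ih fun j hj => hD j (mem_insert_of_mem hj)
    have hDi := hD i (mem_insert_self i s)
    have hu : IsUnit (D i : ℤ_[p]) := by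
      rw [PadicInt.isUnit_iff]
      refine le_antisymm (PadicInt.norm_le_one _) (not_lt.1 fun h => hDi ?_)
      rwa [PadicInt.norm_int_lt_one_iff_dvd] at h
    obtain ⟨v, hv⟩ := hu.exists_right_inv
    refine ⟨A i * v + z, ?_, ?_⟩
    · rw [sum_insert hi, ← hz]
      have h1 : (D i : ℚ_[p]) * v = 1 := by exact_mod_cast congrArg ((↑) : ℤ_[p] → ℚ_[p]) hv
      have h2 : (D i : ℚ_[p]) ≠ 0 := left_ne_zero_of_mul_eq_one h1
      push_cast
      rw [eq_div_of_mul_eq h2 (by rw [mul_comm, h1] : (v : ℚ_[p]) * D i = 1)]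
      ring
    · rw [sum_insert hi, ← hz', map_add, map_mul, map_intCast]
      have h1 : (D i : ZMod (p ^ 2)) * PadicInt.toZModPow 2 v = 1 := by
        rw [← map_intCast (PadicInt.toZModPow (p := p) 2), ← map_mul, hv, map_one]
      have h2 := ZMod.inv_mul_of_unit _ (isUnit_intCast_zmod_sq hDi)
      congr 2
      linear_combination (-PadicInt.toZModPow 2 v) * h2 + (D i : ZMod (p ^ 2))⁻¹ * h1

lemma sum_zmod_sq_eq_of_sum_padic_eq {ι : Type*} {s : Finset ι} {A D : ι → ℤ} {X Y : ℤ}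
    (hD : ∀ i ∈ s, ¬ (p : ℤ) ∣ D i) (hY : ¬ (p : ℤ) ∣ Y)
    (h : ∑ i ∈ s, (A i : ℚ_[p]) / D i = X / Y) :
    (∑ i ∈ s, (A i : ZMod (p ^ 2)) * (D i : ZMod (p ^ 2))⁻¹) * Y = X := by
  obtain ⟨z, hz, hz'⟩ := exists_padicInt_eq_sum_div s A D hD
  have hY0 : (Y : ℚ_[p]) ≠ 0 := by
    rintro h0
    exact hY (by rw [Int.cast_eq_zero.1 h0]; exact dvd_zero _)
  have h1 : z * (Y : ℤ_[p]) = X := by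
    apply Subtype.coe_injective
    push_cast
    rw [hz, h, div_mul_cancel₀ _ hY0]
  rw [← hz', ← map_intCast (PadicInt.toZModPow (p := p) 2) Y, ← map_mul, h1, map_intCast]

/-- The harmonic number `1 + 1/2 + ⋯ + 1/n` modulo `p ^ 2`. -/
def harmonicModSq (p n : ℕ) : ZMod (p ^ 2) := ∑ j ∈ range n, ((j + 1 : ℕ) : ZMod (p ^ 2))⁻¹

lemma harmonicModSq_succ (p n : ℕ) :
    harmonicModSq p (n + 1) = harmonicModSq p n + ((n + 1 : ℕ) : ZMod (p ^ 2))⁻¹ :=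
  sum_range_succ _ _

lemma factorial_mul_prod_add_mul (a n : ℕ) (c : ZMod (p ^ 2)) (h : a + n < p) :
    (a.factorial : ZMod (p ^ 2)) * ∏ i ∈ range n, ((a + n - i : ZMod (p ^ 2)) + c * (p : ZMod (p ^ 2))) =
      ((a + n).factorial : ZMod (p ^ 2)) * (1 + c * (p : ZMod (p ^ 2)) * (harmonicModSq p (a + n) - harmonicModSq p a)) := by
  induction n with
  | zero => simp
  | succ n ih =>
    have ih := ih (by lia)
    have hu := ZMod.mul_inv_of_unit _ (isUnit_natCast_zmod_sq_of_lt (a + n).succ_ne_zero h)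
    have hP := natCast_self_mul_self_zmod_sq (p := p)
    rw [prod_range_succ']
    have hsub : ∀ i ∈ range n, ((a + (n + 1 : ℕ) - (i + 1 : ℕ) : ZMod (p ^ 2)) + c * (p : ZMod (p ^ 2))) =
        (a + n - i : ZMod (p ^ 2)) + c * p := by
      intro i _
      push_cast
      ring
    rw [prod_congr rfl hsub, ← add_assoc, Nat.factorial_succ, harmonicModSq_succ, ← mul_assoc, ih]
    push_cast at hu ⊢
    generalize (a + n + 1 : ZMod (p ^ 2))⁻¹ = v at *
    linear_combination ((a + n).factorial : ZMod (p ^ 2)) * (c ^ 2 *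
      (harmonicModSq p (a + n) - harmonicModSq p a) * hP - c * (p : ZMod (p ^ 2)) * hu)

end ZModSq

lemma two_pow_mul_factorial_mul_prod_odd (n : ℕ) :
    2 ^ n * n.factorial * ∏ i ∈ range n, (2 * i + 1) = (2 * n).factorial := by
  induction n with
  | zero => simp
  | succ n ih =>
    rw [prod_range_succ, show 2 * (n + 1) = 2 * n + 1 + 1 by ring, Nat.factorial_succ (2 * n + 1),
      Nat.factorial_succ (2 * n), Nat.factorial_succ n, ← ih]
    ring

section SixMulAddOne

variable {p m : ℕ} [hp : Fact p.Prime]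

lemma isUnit_two_zmod_sq (hm : p = 6 * m + 1) : IsUnit (2 : ZMod (p ^ 2)) := by
  have := hp.out.two_le
  exact_mod_cast isUnit_natCast_zmod_sq_of_lt (p := p) (n := 2) (by simp) (by lia)

lemma isUnit_three_zmod_sq (hm : p = 6 * m + 1) : IsUnit (3 : ZMod (p ^ 2)) := by
  have := hp.out.two_le
  exact_mod_cast isUnit_natCast_zmod_sq_of_lt (p := p) (n := 3) (by simp) (by lia)

lemma harmonicModSq_four (hm : p = 6 * m + 1) :
    (p : ZMod (p ^ 2)) * harmonicModSq p (4 * m) = (p : ZMod (p ^ 2)) * harmonicModSq p (2 * m) := by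
  have hP := natCast_self_mul_self_zmod_sq (p := p)
  have hsplit : harmonicModSq p (4 * m) = harmonicModSq p (2 * m) +
      ∑ i ∈ range (2 * m), ((2 * m + i + 1 : ℕ) : ZMod (p ^ 2))⁻¹ := by
    rw [harmonicModSq, harmonicModSq, show 4 * m = 2 * m + 2 * m by ring, sum_range_add]
  have hanti : (p : ZMod (p ^ 2)) * ∑ i ∈ range (2 * m), ((2 * m + i + 1 : ℕ) : ZMod (p ^ 2))⁻¹ =
      - ((p : ZMod (p ^ 2)) * ∑ i ∈ range (2 * m), ((2 * m + i + 1 : ℕ) : ZMod (p ^ 2))⁻¹) := by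
    conv_lhs => rw [← sum_range_reflect]
    rw [mul_sum, mul_sum, ← sum_neg_distrib]
    refine sum_congr rfl fun i hi => ?_
    rw [mem_range] at hi
    have h1 := isUnit_natCast_zmod_sq_of_lt (p := p)
      (n := 2 * m + (2 * m - 1 - i) + 1) (by lia) (by lia)
    have h2 := isUnit_natCast_zmod_sq_of_lt (p := p) (n := 2 * m + i + 1) (by lia) (by lia)
    have h3 := ZMod.mul_inv_of_unit _ h1
    have h4 := ZMod.mul_inv_of_unit _ h2
    have h5 : ((2 * m + (2 * m - 1 - i) + 1 : ℕ) : ZMod (p ^ 2)) =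
        (p : ZMod (p ^ 2)) - ((2 * m + i + 1 : ℕ) : ZMod (p ^ 2)) := by
      rw [eq_sub_iff_add_eq, ← Nat.cast_add]
      congr 1
      lia
    rw [h5] at h3 ⊢
    generalize ((2 * m + i + 1 : ℕ) : ZMod (p ^ 2)) = x at *
    linear_combination ((p : ZMod (p ^ 2)) * ((p : ZMod (p ^ 2)) - x)⁻¹) * (-h4) - (p : ZMod (p ^ 2)) * x⁻¹ * h3 + ((p : ZMod (p ^ 2)) - x)⁻¹ * x⁻¹ * hP
  have h2 := isUnit_two_zmod_sq hm
  rw [hsplit]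
  have : (p : ZMod (p ^ 2)) * ∑ i ∈ range (2 * m), ((2 * m + i + 1 : ℕ) : ZMod (p ^ 2))⁻¹ = 0 := by
    apply h2.mul_left_cancel
    linear_combination hanti
  linear_combination this

lemma harmonicModSq_two_add_three (hm : p = 6 * m + 1) :
    (p : ZMod (p ^ 2)) * (harmonicModSq p (2 * m) + harmonicModSq p (3 * m)) = (p : ZMod (p ^ 2)) * harmonicModSq p m := by
  have hu2 := isUnit_two_zmod_sq hm
  have h22 := ZMod.mul_inv_of_unit _ hu2
  have hP := natCast_self_mul_self_zmod_sq (p := p)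
  have h1 : ∀ n, n ≤ m → harmonicModSq p (2 * n) = 2⁻¹ * harmonicModSq p n +
      ∑ i ∈ range n, ((2 * i + 1 : ℕ) : ZMod (p ^ 2))⁻¹ := by
    intro n hn
    induction n with
    | zero => simp [harmonicModSq]
    | succ n ih =>
      rw [show 2 * (n + 1) = 2 * n + 1 + 1 by ring, harmonicModSq_succ, harmonicModSq_succ,
        ih (by lia), harmonicModSq_succ, sum_range_succ]
      have ha := ZMod.mul_inv_of_unit _ (isUnit_natCast_zmod_sq_of_lt (p := p)
        (n := 2 * n + 1 + 1) (by lia) (by lia))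
      have hb := ZMod.mul_inv_of_unit _ (isUnit_natCast_zmod_sq_of_lt (p := p)
        (n := n + 1) (by lia) (by lia))
      have hc : ((2 * n + 1 + 1 : ℕ) : ZMod (p ^ 2)) = 2 * ((n + 1 : ℕ) : ZMod (p ^ 2)) := by
        push_cast; ring
      rw [hc] at ha ⊢
      generalize ((n + 1 : ℕ) : ZMod (p ^ 2)) = x at *
      linear_combination (2⁻¹ * x⁻¹) * ha - (2 * x)⁻¹ * 2⁻¹ * 2 * hb - (2 * x)⁻¹ * h22
  have h2 : (p : ZMod (p ^ 2)) * ∑ i ∈ range m, ((2 * i + 1 : ℕ) : ZMod (p ^ 2))⁻¹ =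
      -(2⁻¹ * ((p : ZMod (p ^ 2)) * (harmonicModSq p (3 * m) - harmonicModSq p (2 * m)))) := by
    have hsplit : harmonicModSq p (3 * m) - harmonicModSq p (2 * m) =
        ∑ i ∈ range m, ((2 * m + i + 1 : ℕ) : ZMod (p ^ 2))⁻¹ := by
      rw [harmonicModSq, harmonicModSq, show 3 * m = 2 * m + m by ring, sum_range_add]
      ring
    rw [hsplit, ← sum_range_reflect, mul_sum, mul_sum, mul_sum, ← sum_neg_distrib]
    refine sum_congr rfl fun i hi => ?_
    rw [mem_range] at hi
    have ha := ZMod.mul_inv_of_unit _ (isUnit_natCast_zmod_sq_of_lt (p := p)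
      (n := 2 * m + i + 1) (by lia) (by lia))
    have hb := ZMod.mul_inv_of_unit _ (isUnit_natCast_zmod_sq_of_lt (p := p)
      (n := 2 * (m - 1 - i) + 1) (by lia) (by lia))
    have hc : ((2 * (m - 1 - i) + 1 : ℕ) : ZMod (p ^ 2)) =
        (p : ZMod (p ^ 2)) - 2 * ((2 * m + i + 1 : ℕ) : ZMod (p ^ 2)) := by
      rw [eq_sub_iff_add_eq]
      exact_mod_cast congrArg (Nat.cast : ℕ → ZMod (p ^ 2))
        (show 2 * (m - 1 - i) + 1 + 2 * (2 * m + i + 1) = p by lia)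
    rw [hc] at hb ⊢
    generalize ((2 * m + i + 1 : ℕ) : ZMod (p ^ 2)) = x at *
    linear_combination (-((p : ZMod (p ^ 2)) * ((p : ZMod (p ^ 2)) - 2 * x)⁻¹)) * (h22 * x * x⁻¹ + ha) - (p : ZMod (p ^ 2)) * 2⁻¹ * x⁻¹ * hb
      + ((p : ZMod (p ^ 2)) - 2 * x)⁻¹ * x⁻¹ * 2⁻¹ * hP
  have h3 := h1 m le_rfl
  linear_combination 2 * (p : ZMod (p ^ 2)) * h3 + 2 * h2 +
    ((p : ZMod (p ^ 2)) * harmonicModSq p m - (p : ZMod (p ^ 2)) * (harmonicModSq p (3 * m) - harmonicModSq p (2 * m))) * h22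

end SixMulAddOne

section SixMulAddOne

variable {p m : ℕ} [hp : Fact p.Prime]

omit hp in
lemma natCast_self_zmod_sq_eq (hm : p = 6 * m + 1) : (p : ZMod (p ^ 2)) = 6 * m + 1 := by
  exact_mod_cast congrArg (Nat.cast : ℕ → ZMod (p ^ 2)) hm

lemma choose_two_thirds_add_choose_third (hm : p = 6 * m + 1) :
    3 * (((9 * m).choose m : ZMod (p ^ 2)) + (9 * m).choose (2 * m)) =
      (3 * m).choose m * (3 + (p : ZMod (p ^ 2)) * (3 * harmonicModSq p (3 * m)
        - 2 * harmonicModSq p (2 * m) - harmonicModSq p m - 6)) := by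
  have hp1 := hp.out.one_lt
  have hP := natCast_self_mul_self_zmod_sq (p := p)
  have hPm := natCast_self_zmod_sq_eq (p := p) hm
  obtain ⟨k, rfl⟩ : ∃ k, m = k + 1 := ⟨m - 1, by lia⟩
  have hB : ((k + 1).factorial : ZMod (p ^ 2)) * (2 * (k + 1)).factorial *
      (3 * (k + 1)).choose (k + 1) = (3 * (k + 1)).factorial := by
    have := Nat.choose_mul_factorial_mul_factorial (n := 3 * (k + 1)) (k := k + 1) (by lia)
    rw [show 3 * (k + 1) - (k + 1) = 2 * (k + 1) by lia] at this
    rw [← this]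
    push_cast
    ring
  have hC : ∀ n, n ≤ 2 * (k + 1) → (n.factorial : ZMod (p ^ 2)) * (9 * (k + 1)).choose n =
      ∏ i ∈ range n, ((9 * (k + 1) : ZMod (p ^ 2)) - i) := by
    intro n hn
    rw [← Nat.cast_mul, ← Nat.descFactorial_eq_factorial_mul_choose,
      Nat.descFactorial_eq_prod_range, Nat.cast_prod]
    refine prod_congr rfl fun i hi => ?_
    rw [mem_range] at hi
    rw [Nat.cast_sub (by lia)]
    push_cast
    rfl
  have hC1 := hC (k + 1) (by lia)
  have hC2 := hC (2 * (k + 1)) le_rfl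
  have h1 := factorial_mul_prod_add_mul (p := p) (2 * k + 1) (k + 1) 1 (by lia)
  have h2 := factorial_mul_prod_add_mul (p := p) k (2 * (k + 1)) 1 (by lia)
  have h1' : ∀ i : ℕ, ((2 * k + 1 : ℕ) : ZMod (p ^ 2)) + (k + 1 : ℕ) - i + 1 * (p : ZMod (p ^ 2)) =
      9 * (k + 1) - i := by
    intro i; rw [hPm]; push_cast; ring
  have h2' : ∀ i : ℕ, ((k : ℕ) : ZMod (p ^ 2)) + (2 * (k + 1) : ℕ) - i + 1 * (p : ZMod (p ^ 2)) =
      9 * (k + 1) - i := by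
    intro i; rw [hPm]; push_cast; ring
  simp only [h1'] at h1
  simp only [h2'] at h2
  rw [← hC1] at h1
  rw [← hC2] at h2
  rw [show 2 * k + 1 + (k + 1) = 3 * k + 2 by ring] at h1
  rw [show k + 2 * (k + 1) = 3 * k + 2 by ring] at h2
  have e1 := harmonicModSq_succ p k
  have e2 := harmonicModSq_succ p (2 * k + 1)
  have e3 := harmonicModSq_succ p (3 * k + 2)
  have f1 := Nat.factorial_succ k
  have f2 := Nat.factorial_succ (2 * k + 1)
  have f3 := Nat.factorial_succ (3 * k + 2)
  have u1 := isUnit_natCast_zmod_sq_of_lt (p := p) (n := k + 1) (by lia) (by lia)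
  have u2 := isUnit_natCast_zmod_sq_of_lt (p := p) (n := 2 * k + 1 + 1) (by lia) (by lia)
  have u3 := isUnit_natCast_zmod_sq_of_lt (p := p) (n := 3 * k + 2 + 1) (by lia) (by lia)
  have i1 := ZMod.mul_inv_of_unit _ u1
  have i2 := ZMod.mul_inv_of_unit _ u2
  have i3 := ZMod.mul_inv_of_unit _ u3
  rw [show 3 * (k + 1) = 3 * k + 2 + 1 by ring, show 2 * (k + 1) = 2 * k + 1 + 1 by ring] at *
  have g1 := isUnit_factorial_zmod_sq (p := p) (n := k + 1) (by lia)
  have g2 := isUnit_factorial_zmod_sq (p := p) (n := 2 * k + 1 + 1) (by lia)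
  have hcancel := (u3.mul g1).mul g2
  apply hcancel.mul_left_cancel
  rw [e1, e2, e3]
  have f1' : ((k + 1).factorial : ZMod (p ^ 2)) = (k + 1 : ℕ) * k.factorial := by
    rw [f1, Nat.cast_mul]
  have f2' : ((2 * k + 1 + 1).factorial : ZMod (p ^ 2)) =
      (2 * k + 1 + 1 : ℕ) * (2 * k + 1).factorial := by
    rw [f2, Nat.cast_mul]
  have f3' : ((3 * k + 2 + 1).factorial : ZMod (p ^ 2)) =
      (3 * k + 2 + 1 : ℕ) * (3 * k + 2).factorial := by
    rw [f3, Nat.cast_mul]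
  have d2 : ((2 * k + 1 + 1 : ℕ) : ZMod (p ^ 2)) = 2 * (k + 1 : ℕ) := by push_cast; ring
  have d3 : ((3 * k + 2 + 1 : ℕ) : ZMod (p ^ 2)) = 3 * (k + 1 : ℕ) := by push_cast; ring
  have dP : (p : ZMod (p ^ 2)) * (6 * (k + 1 : ℕ) + 1) = 0 := by
    rw [← hPm, hP]
  have j1 : (p : ZMod (p ^ 2)) * ((k + 1 : ℕ) : ZMod (p ^ 2))⁻¹ = -6 * p := by
    linear_combination ((k + 1 : ℕ) : ZMod (p ^ 2))⁻¹ * dP - 6 * (p : ZMod (p ^ 2)) * i1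
  have j2 : (p : ZMod (p ^ 2)) * ((2 * k + 1 + 1 : ℕ) : ZMod (p ^ 2))⁻¹ = -3 * p := by
    rw [d2] at i2 ⊢
    linear_combination (2 * (k + 1 : ℕ) : ZMod (p ^ 2))⁻¹ * dP - 3 * (p : ZMod (p ^ 2)) * i2
  have j3 : (p : ZMod (p ^ 2)) * ((3 * k + 2 + 1 : ℕ) : ZMod (p ^ 2))⁻¹ = -2 * p := by
    rw [d3] at i3 ⊢
    linear_combination (3 * (k + 1 : ℕ) : ZMod (p ^ 2))⁻¹ * dP - 2 * (p : ZMod (p ^ 2)) * i3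
  generalize ((3 * k + 2 + 1 : ℕ) : ZMod (p ^ 2))⁻¹ = v3 at *
  generalize ((2 * k + 1 + 1 : ℕ) : ZMod (p ^ 2))⁻¹ = v2 at *
  generalize ((k + 1 : ℕ) : ZMod (p ^ 2))⁻¹ = v1 at *
  rw [d2] at f2'
  rw [d3] at f3' ⊢
  generalize ((k + 1 : ℕ) : ZMod (p ^ 2)) = x at *
  generalize harmonicModSq p k = y1 at *
  generalize harmonicModSq p (2 * k + 1) = y2 at *
  generalize harmonicModSq p (3 * k + 2) = y3 at *
  have hB' := hB
  rw [f3'] at hB'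
  generalize ((k + 1).factorial : ZMod (p ^ 2)) = a at *
  generalize ((2 * k + 1 + 1).factorial : ZMod (p ^ 2)) = b at *
  generalize ((3 * k + 2).factorial : ZMod (p ^ 2)) = c at *
  generalize ((k).factorial : ZMod (p ^ 2)) = a' at *
  generalize ((2 * k + 1).factorial : ZMod (p ^ 2)) = b' at *
  generalize ((9 * (k + 1)).choose (k + 1) : ZMod (p ^ 2)) = C1 at *
  generalize ((9 * (k + 1)).choose (2 * k + 1 + 1) : ZMod (p ^ 2)) = C2 at *
  generalize ((3 * k + 2 + 1).choose (k + 1) : ZMod (p ^ 2)) = B at *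
  have k1 : a * b * C1 = 2 * x * c * (1 + (p : ZMod (p ^ 2)) * (y3 - y2)) := by
    rw [f2']
    linear_combination 2 * x * h1
  have k2 : a * b * C2 = x * c * (1 + (p : ZMod (p ^ 2)) * (y3 - y1)) := by
    rw [f1']
    linear_combination x * h2
  linear_combination 9 * x * (k1 + k2) - 3 * x * (3 + (p : ZMod (p ^ 2)) * (3 * (y3 + v3)
    - 2 * (y2 + v2) - (y1 + v1) - 6)) * hB' - 9 * x ^ 2 * c * (3 * j3 - 2 * j2 - j1)

lemma eq_choose_mul_of_mul_prod_eq_prod (hm : p = 6 * m + 1) {F : ZMod (p ^ 2)}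
    (hF : F * ∏ i ∈ range m, (2 * (6 * i + 1) : ZMod (p ^ 2)) =
      ∏ i ∈ range m, (-(3 * i + 1) : ZMod (p ^ 2))) :
    F = ((3 * m).choose m : ZMod (p ^ 2)) * (1 + (m : ZMod (p ^ 2)) * (p : ZMod (p ^ 2)) * (3 * harmonicModSq p (3 * m)
      - harmonicModSq p (2 * m) - 3 * harmonicModSq p m)) := by
  have hP := natCast_self_mul_self_zmod_sq (p := p)
  have hPm := natCast_self_zmod_sq_eq (p := p) hm
  have hu2 := isUnit_two_zmod_sq hm
  have hu3 := isUnit_three_zmod_sq hm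
  have dP : 6 * (m : ZMod (p ^ 2)) * (p : ZMod (p ^ 2)) = -p := by
    linear_combination hP - (p : ZMod (p ^ 2)) * hPm
  have hB : (m.factorial : ZMod (p ^ 2)) * (2 * m).factorial * (3 * m).choose m =
      (3 * m).factorial := by
    have := Nat.choose_mul_factorial_mul_factorial (n := 3 * m) (k := m) (by lia)
    rw [show 3 * m - m = 2 * m by lia] at this
    rw [← this]
    push_cast
    ring
  have h1 := factorial_mul_prod_add_mul (p := p) 0 m m (by lia)
  have h2 := factorial_mul_prod_add_mul (p := p) m m (2 * m) (by lia)
  have h3 := factorial_mul_prod_add_mul (p := p) (2 * m) m (3 * m) (by lia)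
  have h4 := congrArg (Nat.cast : ℕ → ZMod (p ^ 2)) (two_pow_mul_factorial_mul_prod_odd m)
  have e1 : ∏ i ∈ range m, (2 * (6 * i + 1) : ZMod (p ^ 2)) = (-12) ^ m *
      ∏ i ∈ range m, (((0 : ℕ) + m - i : ZMod (p ^ 2)) + m * (p : ZMod (p ^ 2))) := by
    rw [← card_range m, ← prod_const, card_range, ← prod_mul_distrib]
    refine prod_congr rfl fun i _ => ?_
    push_cast
    linear_combination 2 * dP - 2 * hPm
  have e2 : ∏ i ∈ range m, (-(3 * i + 1) : ZMod (p ^ 2)) = 3 ^ m *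
      ∏ i ∈ range m, ((m + m - i : ZMod (p ^ 2)) + 2 * m * (p : ZMod (p ^ 2))) := by
    rw [← card_range m, ← prod_const, card_range, ← prod_mul_distrib]
    refine prod_congr rfl fun i _ => ?_
    linear_combination -dP + hPm
  have e3 : ∏ i ∈ range m, (2 * i + 1 : ZMod (p ^ 2)) = (-2) ^ m *
      ∏ i ∈ range m, (((2 * m : ℕ) + m - i : ZMod (p ^ 2)) + 3 * m * (p : ZMod (p ^ 2))) := by
    rw [← card_range m, ← prod_const, card_range, ← prod_mul_distrib]
    refine prod_congr rfl fun i _ => ?_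
    push_cast
    linear_combination dP - hPm
  push_cast at h4
  rw [e3] at h4
  rw [e1, e2] at hF
  simp only [Nat.factorial_zero, Nat.cast_one, one_mul, zero_add] at h1
  rw [show harmonicModSq p 0 = 0 by simp [harmonicModSq]] at h1
  rw [h1] at hF
  rw [show m + m = 2 * m by ring] at h2
  rw [show 2 * m + m = 3 * m by ring] at h3
  have ua := isUnit_factorial_zmod_sq (p := p) (n := m) (by lia)
  have ub := isUnit_factorial_zmod_sq (p := p) (n := 2 * m) (by lia)
  have uQ : IsUnit ((-12 : ZMod (p ^ 2)) ^ m) := by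
    rw [show (-12 : ZMod (p ^ 2)) = -(2 * 2 * 3) by norm_num]
    exact ((hu2.mul hu2).mul hu3).neg.pow m
  have hc1 : (2 : ZMod (p ^ 2)) ^ m * (-2) ^ m * 3 ^ m = (-12) ^ m := by
    rw [← mul_pow, ← mul_pow]
    norm_num
  generalize harmonicModSq p m = y1 at *
  generalize harmonicModSq p (2 * m) = y2 at *
  generalize harmonicModSq p (3 * m) = y3 at *
  generalize (m.factorial : ZMod (p ^ 2)) = a at *
  generalize ((2 * m).factorial : ZMod (p ^ 2)) = b at *
  generalize ((3 * m).factorial : ZMod (p ^ 2)) = c at *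
  generalize ((3 * m).choose m : ZMod (p ^ 2)) = B at *
  generalize ∏ i ∈ range m, ((m + m - i : ZMod (p ^ 2)) + 2 * m * (p : ZMod (p ^ 2))) = X2 at *
  generalize ∏ i ∈ range m, (((2 * m : ℕ) + m - i : ZMod (p ^ 2)) + 3 * m * (p : ZMod (p ^ 2))) = X3 at *
  generalize (-12 : ZMod (p ^ 2)) ^ m = Q at *
  have k1 : b * b = 2 ^ m * (-2) ^ m * a * (c * (1 + 3 * m * (p : ZMod (p ^ 2)) * (y3 - y2))) := by
    linear_combination 2 ^ m * (-2) ^ m * a * h3 - b * h4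
  apply (((uQ.mul ua).mul ua).mul ub).mul_left_cancel
  have k2 : Q * a * a * b * (F * (1 + m * (p : ZMod (p ^ 2)) * y1)) = Q * a * a * b *
      (B * (1 + 3 * m * (p : ZMod (p ^ 2)) * (y3 - y2)) * (1 + 2 * m * (p : ZMod (p ^ 2)) * (y2 - y1))) := by
    linear_combination a * b * hF + 3 ^ m * b * h2 +
      3 ^ m * (1 + 2 * m * (p : ZMod (p ^ 2)) * (y2 - y1)) * k1 +
      (a * c * (1 + 3 * m * (p : ZMod (p ^ 2)) * (y3 - y2)) * (1 + 2 * m * (p : ZMod (p ^ 2)) * (y2 - y1))) * hc1 -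
      Q * a * (1 + 3 * m * (p : ZMod (p ^ 2)) * (y3 - y2)) * (1 + 2 * m * (p : ZMod (p ^ 2)) * (y2 - y1)) * hB
  linear_combination (1 - m * (p : ZMod (p ^ 2)) * y1) * k2 + Q * a * a * b * (m ^ 2 * F * y1 ^ 2 + B * m ^ 2 * (
    6 * (y3 - y2) * (y2 - y1) * (1 - m * (p : ZMod (p ^ 2)) * y1) - 3 * (y3 - y2) * y1 - 2 * (y2 - y1) * y1)) * hP

end SixMulAddOne

section SixMulAddOne

variable {p m : ℕ} [hp : Fact p.Prime]

lemma eq_choose_mul_of_mul_prod_eq_prod' (hm : p = 6 * m + 1) {F : ZMod (p ^ 2)}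
    (hF : F * ∏ i ∈ range (3 * m), (6 * (2 * i + 1) : ZMod (p ^ 2)) =
      ∏ i ∈ range (3 * m), (-(3 * i + 2) : ZMod (p ^ 2))) :
    F = ((3 * m).choose m : ZMod (p ^ 2)) * (1 - (m : ZMod (p ^ 2)) * (p : ZMod (p ^ 2)) *
      (2 * harmonicModSq p (2 * m) + 4 * harmonicModSq p m)) := by
  have hP := natCast_self_mul_self_zmod_sq (p := p)
  have hPm := natCast_self_zmod_sq_eq (p := p) hm
  have hu2 := isUnit_two_zmod_sq hm
  have hu3 := isUnit_three_zmod_sq hm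
  have dP : 6 * (m : ZMod (p ^ 2)) * (p : ZMod (p ^ 2)) = -p := by
    linear_combination hP - (p : ZMod (p ^ 2)) * hPm
  have hB : (m.factorial : ZMod (p ^ 2)) * (2 * m).factorial * (3 * m).choose m =
      (3 * m).factorial := by
    have := Nat.choose_mul_factorial_mul_factorial (n := 3 * m) (k := m) (by lia)
    rw [show 3 * m - m = 2 * m by lia] at this
    rw [← this]
    push_cast
    ring
  have h1 := factorial_mul_prod_add_mul (p := p) 0 (2 * m) (-1) (by lia)
  have h2 := factorial_mul_prod_add_mul (p := p) m (3 * m) (4 * m) (by lia)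
  have h4 := congrArg (Nat.cast : ℕ → ZMod (p ^ 2)) (two_pow_mul_factorial_mul_prod_odd (3 * m))
  have h5 := harmonicModSq_four hm
  have h6 : ((4 * m).factorial : ZMod (p ^ 2)) *
      ∏ i ∈ range (2 * m), (((0 : ℕ) + (2 * m : ℕ) - i : ZMod (p ^ 2)) + -1 * (p : ZMod (p ^ 2))) =
      ((2 * (3 * m)).factorial : ZMod (p ^ 2)) := by
    rw [show 2 * (3 * m) = 4 * m + 2 * m by ring, ← Nat.factorial_mul_ascFactorial,
      Nat.ascFactorial_eq_prod_range, Nat.cast_mul (Nat.factorial _), Nat.cast_prod]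
    congr 1
    have hneg : ∀ f : ℕ → ZMod (p ^ 2), ∏ i ∈ range (2 * m), f i = ∏ i ∈ range (2 * m), -f i := by
      intro f
      rw [prod_neg, card_range, (even_two_mul m).neg_one_pow, one_mul]
    rw [hneg]
    refine prod_congr rfl fun i _ => ?_
    rw [hPm]
    push_cast
    ring
  have e1 : ∏ i ∈ range (3 * m), (6 * (2 * i + 1) : ZMod (p ^ 2)) = 6 ^ (3 * m) *
      ∏ i ∈ range (3 * m), (2 * i + 1 : ZMod (p ^ 2)) := by
    conv_rhs => rw [← card_range (3 * m), ← prod_const, card_range, ← prod_mul_distrib]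
  have e2 : ∏ i ∈ range (3 * m), (-(3 * i + 2) : ZMod (p ^ 2)) = 3 ^ (3 * m) *
      ∏ i ∈ range (3 * m), ((m + (3 * m : ℕ) - i : ZMod (p ^ 2)) +
        4 * m * (p : ZMod (p ^ 2))) := by
    conv_rhs => rw [← card_range (3 * m), ← prod_const, card_range, ← prod_mul_distrib]
    refine prod_congr rfl fun i _ => ?_
    push_cast
    linear_combination -2 * dP + 2 * hPm
  rw [e1, e2] at hF
  rw [show m + 3 * m = 4 * m by ring] at h2
  rw [zero_add] at h1
  rw [show harmonicModSq p 0 = 0 by simp [harmonicModSq], Nat.factorial_zero, Nat.cast_one,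
    one_mul] at h1
  rw [h1] at h6
  rw [Nat.cast_mul, Nat.cast_mul, Nat.cast_prod, Nat.cast_pow] at h4
  have e4 : ∏ i ∈ range (3 * m), ((2 * i + 1 : ℕ) : ZMod (p ^ 2)) =
      ∏ i ∈ range (3 * m), (2 * i + 1 : ZMod (p ^ 2)) :=
    prod_congr rfl fun i _ => by push_cast; rfl
  rw [e4, ← h6] at h4
  have ua := isUnit_factorial_zmod_sq (p := p) (n := m) (by lia)
  have uc := isUnit_factorial_zmod_sq (p := p) (n := 3 * m) (by lia)
  have ud := isUnit_factorial_zmod_sq (p := p) (n := 4 * m) (by lia)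
  have ub := isUnit_factorial_zmod_sq (p := p) (n := 2 * m) (by lia)
  have u3 := hu3.pow (3 * m)
  have hc1 : (6 : ZMod (p ^ 2)) ^ (3 * m) = ((2 : ℕ) : ZMod (p ^ 2)) ^ (3 * m) * 3 ^ (3 * m) := by
    rw [← mul_pow]
    norm_num
  rw [hc1] at hF
  generalize ((2 : ℕ) : ZMod (p ^ 2)) ^ (3 * m) = A at *
  generalize (3 : ZMod (p ^ 2)) ^ (3 * m) = D at *
  generalize ∏ i ∈ range (3 * m), (2 * i + 1 : ZMod (p ^ 2)) = X1 at *
  generalize ∏ i ∈ range (3 * m), ((m + (3 * m : ℕ) - i : ZMod (p ^ 2)) +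
        4 * m * (p : ZMod (p ^ 2))) = X2 at *
  generalize harmonicModSq p m = y1 at *
  generalize harmonicModSq p (2 * m) = y2 at *
  generalize harmonicModSq p (4 * m) = y4 at *
  generalize (m.factorial : ZMod (p ^ 2)) = a at *
  generalize ((2 * m).factorial : ZMod (p ^ 2)) = b at *
  generalize ((3 * m).factorial : ZMod (p ^ 2)) = c at *
  generalize ((4 * m).factorial : ZMod (p ^ 2)) = d at *
  generalize ((3 * m).choose m : ZMod (p ^ 2)) = B at *
  generalize (p : ZMod (p ^ 2)) = P at *
  generalize (m : ZMod (p ^ 2)) = M at *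
  have k1 : F * (A * X1) = X2 := by
    apply u3.mul_left_cancel
    linear_combination hF
  have k2 : F * (1 - P * y2) = B * (1 + 4 * M * P * (y4 - y1)) := by
    apply (((ua.mul ud).mul ub)).mul_left_cancel
    linear_combination c * a * k1 + c * h2 - a * F * h4 - d * (1 + 4 * M * P * (y4 - y1)) * hB
  linear_combination (1 + P * y2) * k2 + F * y2 ^ 2 * hP + 4 * M * B * (1 + P * y2) * h5
    + 4 * M * B * y2 * (y2 - y1) * hP + B * y2 * dP
end SixMulAddOne

/-- The product `(1 - y) (3 - y) ⋯ (4 k - 1 - y)`. -/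
def hyperNum (k : ℕ) (y : ℤ) : ℤ := ∏ i ∈ range (2 * k), (1 + 2 * (i : ℤ) - y)

/-- The product `4 ^ k * k! * (3 - y) (6 - y) ⋯ (3 k - y)`. -/
def hyperDen (k : ℕ) (y : ℤ) : ℤ := 4 ^ k * k.factorial * ∏ j ∈ range k, (3 * (j + 1 : ℤ) - y)

lemma hyperTerm_natCast {K : Type*} [Field K] [CharZero K] (N k : ℕ) :
    hyperTerm (N : K) k = (hyperNum k (2 * N + 1) : K) / (hyperDen k (2 * N + 1) : K) := by
  have h1 : (hyperNum k (2 * N + 1) : K) = 4 ^ k * ∏ i ∈ range (2 * k), ((N : K) - i) := by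
    have : (4 : K) ^ k = ∏ i ∈ range (2 * k), (-2 : K) := by
      rw [prod_const, card_range, pow_mul]
      norm_num
    rw [this, ← prod_mul_distrib, hyperNum, Int.cast_prod]
    refine prod_congr rfl fun i _ => ?_
    push_cast
    ring
  have h2 : (hyperDen k (2 * N + 1) : K) =
      4 ^ k * (k.factorial * ∏ j ∈ range k, (3 * (j : K) + 2 - 2 * N)) := by
    rw [hyperDen]
    push_cast
    rw [mul_assoc]
    congr 2
    refine prod_congr rfl fun i _ => ?_
    ring
  rw [hyperTerm, h1, h2, mul_div_mul_left _ _ (pow_ne_zero k (by norm_num))]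

lemma choose_mul_choose_div_pow {K : Type*} [Field K] [CharZero K] (k : ℕ) :
    (((2 * k).choose k : K) * ((4 * k).choose (2 * k) : K)) / (48 : K) ^ k =
      (hyperNum k 0 : K) / (hyperDen k 0 : K) := by
  have h1 := two_pow_mul_factorial_mul_prod_odd (2 * k)
  have h2 := Nat.choose_mul_factorial_mul_factorial (n := 2 * k) (k := k) (by lia)
  have h3 := Nat.choose_mul_factorial_mul_factorial (n := 4 * k) (k := 2 * k) (by lia)
  rw [show 2 * k - k = k by lia] at h2
  rw [show 4 * k - 2 * k = 2 * k by lia] at h3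
  rw [show 2 * (2 * k) = 4 * k by lia, pow_mul] at h1
  have hn : (hyperNum k 0 : K) = ((∏ i ∈ range (2 * k), (2 * i + 1) : ℕ) : K) := by
    rw [hyperNum]
    push_cast
    exact prod_congr rfl fun i _ => by ring
  have hd : (hyperDen k 0 : K) = 12 ^ k * k.factorial * k.factorial := by
    have : ∏ j ∈ range k, (3 * (j + 1 : ℤ) - 0) = 3 ^ k * k.factorial := by
      rw [← prod_range_add_one_eq_factorial]
      push_cast
      conv_rhs => rw [← card_range k, ← prod_const, card_range, ← prod_mul_distrib]
      exact prod_congr rfl fun i _ => by ring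
    rw [hyperDen, this, show (12 : K) = 4 * 3 by norm_num, mul_pow]
    push_cast
    ring
  rw [hn, hd]
  generalize ∏ i ∈ range (2 * k), (2 * i + 1) = X at *
  have hk : (k.factorial : K) ≠ 0 := by exact_mod_cast k.factorial_ne_zero
  have hk2 : ((2 * k).factorial : K) ≠ 0 := by exact_mod_cast (2 * k).factorial_ne_zero
  have h48 : (48 : K) ^ k = (2 ^ 2) ^ k * 12 ^ k := by
    rw [← mul_pow]
    norm_num
  rw [div_eq_div_iff (pow_ne_zero k (by norm_num))
    (mul_ne_zero (mul_ne_zero (pow_ne_zero k (by norm_num)) hk) hk), h48]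
  apply mul_left_cancel₀ hk2
  have h1' : ((2 : K) ^ 2) ^ k * (2 * k).factorial * X = (4 * k).factorial := by exact_mod_cast h1
  have h2' : ((2 * k).choose k : K) * k.factorial * k.factorial = (2 * k).factorial := by
    exact_mod_cast h2
  have h3' : ((4 * k).choose (2 * k) : K) * (2 * k).factorial * (2 * k).factorial =
    (4 * k).factorial := by exact_mod_cast h3
  linear_combination 12 ^ k * (4 * k).choose (2 * k) * (2 * k).factorial * h2' + 12 ^ k * h3'
    - 12 ^ k * h1'

section

variable {p m : ℕ} [hp : Fact p.Prime]

omit hp in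
lemma exists_prod_sub_mul (c : ℕ → ZMod (p ^ 2)) (n : ℕ) :
    ∃ d : ZMod (p ^ 2), ∀ t : ZMod (p ^ 2), ∏ i ∈ range n, (c i - t * (p : ZMod (p ^ 2))) =
      ∏ i ∈ range n, c i + t * d * (p : ZMod (p ^ 2)) := by
  induction n with
  | zero => exact ⟨0, by simp⟩
  | succ n ih =>
    obtain ⟨d, hd⟩ := ih
    refine ⟨d * c n - ∏ i ∈ range n, c i, fun t => ?_⟩
    rw [prod_range_succ, prod_range_succ, hd]
    linear_combination (-t ^ 2 * d) * natCast_self_mul_self_zmod_sq (p := p)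

lemma not_dvd_hyperDen (hp3 : 3 < p) {k : ℕ} (hk : k < p) {y : ℤ} (hy : (p : ℤ) ∣ y) :
    ¬ (p : ℤ) ∣ hyperDen k y := by
  have hpi := Nat.prime_iff_prime_int.1 hp.out
  have hnat : ∀ n : ℕ, n ≠ 0 → n < p → ¬ (p : ℤ) ∣ n := fun n h0 hn h => by
    have := Nat.le_of_dvd (by lia) (Int.natCast_dvd_natCast.1 h)
    lia
  rw [hyperDen, hpi.dvd_mul, hpi.dvd_mul, hpi.dvd_finsetProd_iff]
  rintro ((h | h) | ⟨j, hj, h⟩)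
  · have := hpi.dvd_of_dvd_pow h
    rw [show (4 : ℤ) = 2 * 2 by norm_num, hpi.dvd_mul, or_self] at this
    exact hnat 2 (by simp) (by lia) (by exact_mod_cast this)
  · have := hp.out.dvd_factorial.1 (Int.natCast_dvd_natCast.1 h)
    lia
  · rw [mem_range] at hj
    rw [dvd_sub_left hy, hpi.dvd_mul] at h
    rcases h with h | h
    · exact hnat 3 (by simp) hp3 (by exact_mod_cast h)
    · exact hnat (j + 1) (by simp) (by lia) (by exact_mod_cast h)

lemma two_mul_hyperNum_mul_inv_hyperDen (hp3 : 3 < p) {k : ℕ} (hk : k < p) :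
    2 * ((hyperNum k 0 : ZMod (p ^ 2)) * (hyperDen k 0 : ZMod (p ^ 2))⁻¹) =
      3 * ((hyperNum k p : ZMod (p ^ 2)) * (hyperDen k p : ZMod (p ^ 2))⁻¹) -
      (hyperNum k (3 * p) : ZMod (p ^ 2)) * (hyperDen k (3 * p) : ZMod (p ^ 2))⁻¹ := by
  obtain ⟨d, hd⟩ := exists_prod_sub_mul (p := p) (fun i => 1 + 2 * (i : ZMod (p ^ 2))) (2 * k)
  obtain ⟨e, he⟩ := exists_prod_sub_mul (p := p) (fun j => 3 * ((j : ZMod (p ^ 2)) + 1)) k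
  have hP := natCast_self_mul_self_zmod_sq (p := p)
  have h0 := ZMod.mul_inv_of_unit _ (isUnit_intCast_zmod_sq
    (not_dvd_hyperDen hp3 hk (dvd_zero (p : ℤ))))
  have h1 := ZMod.mul_inv_of_unit _ (isUnit_intCast_zmod_sq
    (not_dvd_hyperDen hp3 hk (dvd_refl (p : ℤ))))
  have h3 := ZMod.mul_inv_of_unit _ (isUnit_intCast_zmod_sq
    (not_dvd_hyperDen hp3 hk (Dvd.intro_left (3 : ℤ) (rfl : 3 * (p : ℤ) = 3 * p))))
  have d1 := hd 1
  have d3 := hd 3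
  have e1 := he 1
  have e3 := he 3
  rw [one_mul] at d1 e1
  have n0 : (hyperNum k 0 : ZMod (p ^ 2)) = ∏ i ∈ range (2 * k), (1 + 2 * (i : ZMod (p ^ 2))) := by
    simp [hyperNum]
  have n1 : (hyperNum k p : ZMod (p ^ 2)) =
      ∏ i ∈ range (2 * k), (1 + 2 * (i : ZMod (p ^ 2)) - (p : ZMod (p ^ 2))) := by
    simp [hyperNum]
  have n3 : (hyperNum k (3 * p) : ZMod (p ^ 2)) =
      ∏ i ∈ range (2 * k), (1 + 2 * (i : ZMod (p ^ 2)) - 3 * (p : ZMod (p ^ 2))) := by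
    simp [hyperNum]
  have m0 : (hyperDen k 0 : ZMod (p ^ 2)) = 4 ^ k * (k.factorial : ZMod (p ^ 2)) *
      ∏ j ∈ range k, (3 * ((j : ZMod (p ^ 2)) + 1)) := by
    simp [hyperDen]
  have m1 : (hyperDen k p : ZMod (p ^ 2)) = 4 ^ k * (k.factorial : ZMod (p ^ 2)) *
      ∏ j ∈ range k, (3 * ((j : ZMod (p ^ 2)) + 1) - (p : ZMod (p ^ 2))) := by
    simp [hyperDen]
  have m3 : (hyperDen k (3 * p) : ZMod (p ^ 2)) = 4 ^ k * (k.factorial : ZMod (p ^ 2)) *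
      ∏ j ∈ range k, (3 * ((j : ZMod (p ^ 2)) + 1) - 3 * (p : ZMod (p ^ 2))) := by
    simp [hyperDen]
  rw [one_mul] at d1 e1
  rw [e1] at m1
  rw [e3] at m3
  rw [n1, n3, d1, d3, ← n0]
  generalize (hyperNum k 0 : ZMod (p ^ 2)) = N0
  generalize (hyperDen k 0 : ZMod (p ^ 2)) = D0 at *
  generalize (hyperDen k p : ZMod (p ^ 2)) = D1 at *
  generalize (hyperDen k (3 * p) : ZMod (p ^ 2)) = D3 at *
  generalize D0⁻¹ = v at *
  generalize D1⁻¹ = v1 at *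
  generalize D3⁻¹ = v3 at *
  obtain ⟨f, m1, m3⟩ : ∃ f, D1 = D0 + f * (p : ZMod (p ^ 2)) ∧
      D3 = D0 + 3 * f * (p : ZMod (p ^ 2)) :=
    ⟨4 ^ k * (k.factorial : ZMod (p ^ 2)) * e, by rw [m1, m0]; ring, by rw [m3, m0]; ring⟩
  generalize (p : ZMod (p ^ 2)) = P at *
  have i1 : v1 = v - f * P * v ^ 2 := by
    subst m1
    linear_combination (v - f * P * v ^ 2) * h1 - (v1 - v1 * f * P * v) * h0 + f ^ 2 * v1 * v ^ 2 * hP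
  have i3 : v3 = v - 3 * f * P * v ^ 2 := by
    subst m3
    linear_combination (v - 3 * f * P * v ^ 2) * h3 - (v3 - 3 * v3 * f * P * v) * h0
      + 9 * f ^ 2 * v3 * v ^ 2 * hP
  rw [i1, i3]
  linear_combination (-6 * d * f * v ^ 2) * hP

/-- The sum `∑ k < p, C(2k, k) C(4k, 2k) / 48 ^ k` modulo `p ^ 2`. -/
lemma two_mul_sum_hyperNum_mul_inv_hyperDen (hm : p = 6 * m + 1) :
    2 * ∑ k ∈ range p, (hyperNum k 0 : ZMod (p ^ 2)) * (hyperDen k 0 : ZMod (p ^ 2))⁻¹ =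
      ((3 * m).choose m : ZMod (p ^ 2)) * (2 + (m : ZMod (p ^ 2)) * (p : ZMod (p ^ 2)) *
      (9 * harmonicModSq p (3 * m) - harmonicModSq p (2 * m) - 5 * harmonicModSq p m)) := by
  have hp1 := hp.out.one_lt
  have hpi := Nat.prime_iff_prime_int.1 hp.out
  have hnat : ∀ n : ℕ, n ≠ 0 → n < p → ¬ (p : ℤ) ∣ n := fun n h0 hn h => by
    have := Nat.le_of_dvd (by lia) (Int.natCast_dvd_natCast.1 h)
    lia
  have hp3 : 3 < p := by lia
  have h1 := sum_hyperTerm_three_mul (K := ℚ_[p]) (m := m) (n := p) (by lia)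
  have h2 := sum_hyperTerm_three_mul_add_one (K := ℚ_[p]) (m := 3 * m) (n := p) (by lia) (by lia)
  simp only [hyperTerm_natCast, ← neg_div, prod_div_distrib] at h1 h2
  rw [show (2 * (3 * m : ℕ) + 1 : ℤ) = p by rw [hm]; push_cast; ring] at h1
  rw [show (2 * (3 * (3 * m) + 1 : ℕ) + 1 : ℤ) = 3 * p by rw [hm]; push_cast; ring] at h2
  have g1 := sum_zmod_sq_eq_of_sum_padic_eq (p := p) (s := range p) (A := fun k => hyperNum k p)
    (D := fun k => hyperDen k p) (X := ∏ i ∈ range m, -(3 * (i : ℤ) + 1))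
    (Y := ∏ i ∈ range m, (2 * (6 * (i : ℤ) + 1)))
    (fun k hk => not_dvd_hyperDen hp3 (mem_range.1 hk) dvd_rfl) (by
      rw [hpi.dvd_finsetProd_iff]
      rintro ⟨i, hi, h⟩
      rw [mem_range] at hi
      rcases hpi.dvd_or_dvd h with h | h
      · exact hnat 2 (by simp) (by lia) (by exact_mod_cast h)
      · exact hnat (6 * i + 1) (by simp) (by lia) (by exact_mod_cast h)) (by
      rw [h1]; push_cast; rfl)
  have g2 := sum_zmod_sq_eq_of_sum_padic_eq (p := p) (s := range p)
    (A := fun k => hyperNum k (3 * p)) (D := fun k => hyperDen k (3 * p))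
    (X := ∏ i ∈ range (3 * m), -(3 * (i : ℤ) + 2))
    (Y := ∏ i ∈ range (3 * m), (6 * (2 * (i : ℤ) + 1)))
    (fun k hk => not_dvd_hyperDen hp3 (mem_range.1 hk) (dvd_mul_left _ _)) (by
      rw [hpi.dvd_finsetProd_iff]
      rintro ⟨i, hi, h⟩
      rw [mem_range] at hi
      rcases hpi.dvd_or_dvd h with h | h
      · exact hnat 6 (by simp) (by lia) (by exact_mod_cast h)
      · exact hnat (2 * i + 1) (by simp) (by lia) (by exact_mod_cast h)) (by
      rw [h2]; push_cast; rfl)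
  push_cast at g1 g2
  have f1 := eq_choose_mul_of_mul_prod_eq_prod hm g1
  have f2 := eq_choose_mul_of_mul_prod_eq_prod' hm g2
  rw [mul_sum, sum_congr rfl fun k hk => two_mul_hyperNum_mul_inv_hyperDen hp3 (mem_range.1 hk),
    sum_sub_distrib, ← mul_sum, f1, f2]
  ring

end

lemma sum_range_three_mul {M : Type*} [AddCommMonoid M] (f : ℕ → M) (n : ℕ) :
    ∑ e ∈ range (3 * n), f e =
      ∑ j ∈ range n, f (3 * j) + ∑ j ∈ range n, f (3 * j + 1) + ∑ j ∈ range n, f (3 * j + 2) := by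
  induction n with
  | zero => simp
  | succ n ih =>
    simp only [show 3 * (n + 1) = 3 * n + 1 + 1 + 1 by ring, sum_range_succ, ih]
    abel

lemma two_dvd_sum_sub_card {ι : Type*} (s : Finset ι) (f : ι → ℤ)
    (hf : ∀ i ∈ s, f i = 1 ∨ f i = -1) : 2 ∣ ∑ i ∈ s, f i - s.card := by
  rw [card_eq_sum_ones, Nat.cast_sum, ← sum_sub_distrib]
  refine dvd_sum fun i hi => ?_
  rcases hf i hi with h | h <;> rw [h] <;> norm_num

/-- A prime has at most one representation `a ^ 2 + 3 * b ^ 2`, up to signs. -/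
lemma sq_eq_sq_of_prime_eq_sq_add_three_mul_sq {p a b c d : ℤ} (hp : Prime p) (hp0 : 0 < p)
    (h1 : p = a ^ 2 + 3 * b ^ 2) (h2 : p = c ^ 2 + 3 * d ^ 2) : a ^ 2 = c ^ 2 := by
  have key : ∀ e : ℤ, p = c ^ 2 + 3 * e ^ 2 → p ∣ a * e - c * b → a ^ 2 = c ^ 2 := by
    rintro e he ⟨t, ht⟩
    have h3 : p * p = (a * c + 3 * b * e) ^ 2 + 3 * (p * t) ^ 2 := by
      rw [← ht]
      linear_combination p * h1 + (a ^ 2 + 3 * b ^ 2) * he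
    have ht0 : t = 0 := by
      by_contra h0
      have : 1 ≤ t ^ 2 := by
        have := sq_pos_of_ne_zero h0
        lia
      nlinarith [sq_nonneg (a * c + 3 * b * e), mul_pos hp0 hp0]
    rw [ht0, mul_zero] at ht
    apply mul_left_cancel₀ hp0.ne'
    linear_combination a ^ 2 * he - c ^ 2 * h1 + 3 * (a * e + c * b) * ht
  have h3 : p ∣ (a * d - c * b) * (a * d + c * b) := ⟨d ^ 2 - b ^ 2, by
    linear_combination (-d ^ 2) * h1 + b ^ 2 * h2⟩
  rcases hp.dvd_or_dvd h3 with h | h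
  · exact key d h2 h
  · refine key (-d) (by rw [neg_sq]; exact h2) ?_
    rw [← dvd_neg]
    convert h using 1
    ring

section

variable {p m : ℕ} [hp : Fact p.Prime] {g : ZMod p}

lemma exists_isPrimitiveRoot_zmod (p : ℕ) [hp : Fact p.Prime] :
    ∃ g : ZMod p, IsPrimitiveRoot g (p - 1) := by
  obtain ⟨g, hg⟩ := IsCyclic.exists_ofOrder_eq_natCard (α := (ZMod p)ˣ)
  refine ⟨g, ?_⟩
  rw [IsPrimitiveRoot.coe_units_iff, IsPrimitiveRoot.iff_orderOf, hg, Nat.card_eq_fintype_card,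
    ZMod.card_units]

lemma sum_zmod_eq_add_sum_pow {M : Type*} [AddCommMonoid M] (hg : IsPrimitiveRoot g (p - 1))
    (f : ZMod p → M) : ∑ x, f x = f 0 + ∑ e ∈ range (p - 1), f (g ^ e) := by
  classical
  have hp1 := hp.out.one_lt
  have hg0 : g ≠ 0 := hg.ne_zero (by lia)
  rw [← add_sum_erase _ _ (mem_univ (0 : ZMod p))]
  congr 1
  have hinj : Set.InjOn (fun e : ℕ => g ^ e) (range (p - 1)) := by
    intro i hi j hj h
    exact hg.pow_inj (by simpa using hi) (by simpa using hj) h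
  rw [← sum_image (s := range (p - 1)) (g := fun e : ℕ => g ^ e) hinj]
  congr 1
  symm
  refine eq_of_subset_of_card_le (fun x hx => ?_) ?_
  · obtain ⟨e, _, rfl⟩ := mem_image.1 hx
    exact mem_erase.2 ⟨pow_ne_zero _ hg0, mem_univ _⟩
  · rw [card_image_of_injOn hinj, card_range, card_erase_of_mem (mem_univ _), card_univ, ZMod.card]

/-- The sum of the quadratic character of `1 - x` over all `x = g ^ e` with `e < 6 * m` and
`e ≡ i (mod 3)`. -/
def cubicClassSum (g : ZMod p) (m i : ℕ) : ℤ :=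
  ∑ j ∈ range (2 * m), quadraticChar (ZMod p) (1 - g ^ (3 * j + i))

lemma sum_pow_mul_quadraticChar {A : Type*} [CommRing A] {w : A} (hw : w ^ 3 = 1) :
    ∑ e ∈ range (6 * m), w ^ e * (quadraticChar (ZMod p) (1 - g ^ e) : A) =
      cubicClassSum g m 0 + cubicClassSum g m 1 * w + cubicClassSum g m 2 * w ^ 2 := by
  rw [show 6 * m = 3 * (2 * m) by ring, sum_range_three_mul]
  simp only [cubicClassSum, pow_add w, pow_mul w, hw, one_pow, one_mul, Int.cast_sum, sum_mul,
    add_zero, pow_one]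
  simp only [mul_comm]

lemma quadraticChar_one_sub_pow (hg : IsPrimitiveRoot g (p - 1)) {e : ℕ} (he : ¬ (p - 1) ∣ e) :
    quadraticChar (ZMod p) (1 - g ^ e) = 1 ∨ quadraticChar (ZMod p) (1 - g ^ e) = -1 := by
  refine quadraticChar_dichotomy fun h => he ((hg.pow_eq_one_iff_dvd e).1 ?_)
  linear_combination -h

lemma cubicClassSum_add_add (hm : p = 6 * m + 1) (hg : IsPrimitiveRoot g (p - 1)) :
    cubicClassSum g m 0 + cubicClassSum g m 1 + cubicClassSum g m 2 = -1 := by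
  have hp1 := hp.out.one_lt
  have h1 := sum_pow_mul_quadraticChar (p := p) (m := m) (g := g) (w := (1 : ℤ)) (one_pow 3)
  have h2 := sum_zmod_eq_add_sum_pow hg fun x => quadraticChar (ZMod p) (1 - x)
  have h3 : ∑ x : ZMod p, quadraticChar (ZMod p) (1 - x) = 0 := by
    rw [← quadraticChar_sum_zero (F := ZMod p) (by rw [ZMod.ringChar_zmod_n]; lia)]
    exact Equiv.sum_comp (Equiv.subLeft (1 : ZMod p)) fun x => quadraticChar (ZMod p) x
  rw [h3, show p - 1 = 6 * m by lia] at h2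
  simp only [one_pow, one_mul, mul_one, Int.cast_id, sub_zero, map_one] at h1 h2
  lia

lemma two_dvd_cubicClassSum (hm : p = 6 * m + 1) (hg : IsPrimitiveRoot g (p - 1)) {i : ℕ}
    (hi : i % 3 ≠ 0) : 2 ∣ cubicClassSum g m i := by
  have h := two_dvd_sum_sub_card (range (2 * m))
    (fun j => quadraticChar (ZMod p) (1 - g ^ (3 * j + i))) fun j _ =>
      quadraticChar_one_sub_pow hg fun h => by
        have h3 : 3 ∣ 3 * j + i := dvd_trans ⟨2 * m, by lia⟩ h
        lia
  rw [card_range] at h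
  rw [cubicClassSum]
  push_cast at h
  lia

lemma cubicClassSum_norm (hm : p = 6 * m + 1) (hg : IsPrimitiveRoot g (p - 1)) :
    cubicClassSum g m 0 ^ 2 + cubicClassSum g m 1 ^ 2 + cubicClassSum g m 2 ^ 2
      - cubicClassSum g m 0 * cubicClassSum g m 1 - cubicClassSum g m 1 * cubicClassSum g m 2
      - cubicClassSum g m 2 * cubicClassSum g m 0 = p := by
  have hp1 := hp.out.one_lt
  have hg0 : g ≠ 0 := hg.ne_zero (by lia)
  obtain ⟨χ, hχ⟩ := MulChar.exists_mulChar_orderOf (ZMod p) (R := ℂ) (n := 3)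
    (by rw [ZMod.card]; exact ⟨2 * m, by lia⟩) (Complex.isPrimitiveRoot_exp 3 (by simp))
  have hχ3 : χ ^ 3 = 1 := by rw [← hχ, pow_orderOf_eq_one]
  have hχ1 : χ ≠ 1 := by
    rintro rfl
    rw [orderOf_one] at hχ
    lia
  set φ : MulChar (ZMod p) ℂ := (quadraticChar (ZMod p)).ringHomComp (Int.castRingHom ℂ) with hφ
  have hφ1 : φ ≠ 1 := (MulChar.ringHomComp_ne_one_iff Int.cast_injective).2
    (quadraticChar_ne_one (by rw [ZMod.ringChar_zmod_n]; lia))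
  have hφ2 : φ ^ 2 = 1 := ((quadraticChar_isQuadratic (ZMod p)).comp _).sq_eq_one
  have hφ' : φ⁻¹ = φ := ((quadraticChar_isQuadratic (ZMod p)).comp _).inv
  have hχφ : χ * φ ≠ 1 := by
    intro h
    apply hφ1
    have : (χ * φ) ^ 3 = φ := by
      rw [mul_pow, hχ3, pow_succ, hφ2, one_mul, one_mul]
    rw [← this, h, one_pow]
  have hJ := jacobiSum_mul_jacobiSum_inv (by rw [ZMod.ringChar_zmod_n, ringChar.eq_zero]; lia)
    hχ1 hφ1 hχφ
  have hsum : ∀ ψ : MulChar (ZMod p) ℂ, jacobiSum ψ φ =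
      ∑ e ∈ range (6 * m), ψ g ^ e * (quadraticChar (ZMod p) (1 - g ^ e) : ℂ) := by
    intro ψ
    rw [jacobiSum, sum_zmod_eq_add_sum_pow hg, ψ.map_zero, zero_mul, zero_add,
      show p - 1 = 6 * m by lia]
    refine sum_congr rfl fun e _ => ?_
    rw [map_pow, hφ, MulChar.ringHomComp_apply, eq_intCast]
  have hw3 : χ g ^ 3 = 1 := by
    rw [← MulChar.pow_apply' χ (by simp), hχ3, MulChar.one_apply hg0.isUnit]
  have hw1 : χ g ≠ 1 := by
    intro h
    apply hχ1
    ext x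
    have : NeZero (p - 1) := ⟨by lia⟩
    obtain ⟨e, _, he⟩ := hg.eq_pow_of_pow_eq_one (ZMod.pow_card_sub_one_eq_one x.ne_zero)
    rw [← he, map_pow, h, one_pow, MulChar.one_apply (hg0.isUnit.pow e)]
  have hinv : χ⁻¹ g = χ g ^ 2 := by
    rw [show χ⁻¹ = χ ^ 2 from inv_eq_of_mul_eq_one_right (by rw [← pow_succ', hχ3]),
      MulChar.pow_apply' χ (by simp)]
  have hw : χ g ^ 2 + χ g + 1 = 0 := by
    apply mul_left_cancel₀ (sub_ne_zero.2 hw1)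
    linear_combination hw3
  rw [hφ', hsum, hsum, hinv, sum_pow_mul_quadraticChar hw3,
    sum_pow_mul_quadraticChar (by rw [← pow_mul, mul_comm, pow_mul, hw3, one_pow]), ZMod.card] at hJ
  generalize χ g = w at *
  generalize cubicClassSum g m 0 = n0 at *
  generalize cubicClassSum g m 1 = n1 at *
  generalize cubicClassSum g m 2 = n2 at *
  have : ((n0 ^ 2 + n1 ^ 2 + n2 ^ 2 - n0 * n1 - n1 * n2 - n2 * n0 : ℤ) : ℂ) = (p : ℤ) := by
    push_cast
    linear_combination hJ - (n1 ^ 2 + n2 ^ 2 * (w ^ 3 + 1) + n0 * n2 * w + n1 * n2 * (w ^ 2 + w)) * hw3 - (n0 * n1 + n1 * n2 + n0 * n2) * hw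
  exact_mod_cast this

lemma two_mul_cubicClassSum_sub_sub (hm : p = 6 * m + 1) (hg : IsPrimitiveRoot g (p - 1))
    {a b : ℤ} (hab : (p : ℤ) = a ^ 2 + 3 * b ^ 2) (ha : a % 3 = 1) :
    2 * cubicClassSum g m 0 - cubicClassSum g m 1 - cubicClassSum g m 2 = -2 * a := by
  have h1 := cubicClassSum_add_add hm hg
  have h2 := cubicClassSum_norm hm hg
  obtain ⟨u, hu⟩ := two_dvd_cubicClassSum hm hg (i := 1) (by simp)
  obtain ⟨v, hv⟩ := two_dvd_cubicClassSum hm hg (i := 2) (by simp)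
  generalize cubicClassSum g m 0 = n0 at *
  rw [hu, hv] at h1 h2 ⊢
  obtain rfl : n0 = -1 - 2 * u - 2 * v := by lia
  have h3 : (p : ℤ) = (-1 - 3 * u - 3 * v) ^ 2 + 3 * (u - v) ^ 2 := by
    rw [← h2]
    ring
  have hpi := Nat.prime_iff_prime_int.1 hp.out
  have h4 := sq_eq_sq_of_prime_eq_sq_add_three_mul_sq hpi (by exact_mod_cast hp.out.pos) hab h3
  rcases sq_eq_sq_iff_eq_or_eq_neg.1 h4 with h | h <;> lia

end

section

variable {p m : ℕ} [hp : Fact p.Prime]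

/-- Reduction modulo `p` of residues modulo `p ^ 2`. -/
def reduceModSq (p : ℕ) : ZMod (p ^ 2) →+* ZMod p := ZMod.castHom (dvd_pow_self p two_ne_zero) _

lemma exists_eq_add_mul_of_reduceModSq_eq {x y : ZMod (p ^ 2)}
    (h : reduceModSq p x = reduceModSq p y) : ∃ w, x = y + (p : ZMod (p ^ 2)) * w := by
  have h0 : reduceModSq p (x - y) = 0 := by rw [map_sub, h, sub_self]
  obtain ⟨n, hn⟩ := ZMod.intCast_surjective (x - y)
  rw [← hn, map_intCast, ZMod.intCast_zmod_eq_zero_iff_dvd] at h0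
  obtain ⟨k, rfl⟩ := h0
  refine ⟨k, ?_⟩
  push_cast at hn
  rw [hn]
  ring

lemma pow_eq_pow_of_reduceModSq_eq {x y : ZMod (p ^ 2)}
    (h : reduceModSq p x = reduceModSq p y) : x ^ p = y ^ p := by
  obtain ⟨w, hw⟩ := exists_eq_add_mul_of_reduceModSq_eq h
  have h1 := dvd_sub_pow_of_dvd_sub (p := p) (a := x) (b := y) ⟨w, by rw [hw]; ring⟩ 1
  rw [pow_one, one_add_one_eq_two, ← Nat.cast_pow, ZMod.natCast_self, zero_dvd_iff] at h1
  exact sub_eq_zero.1 h1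

lemma isUnit_of_reduceModSq_ne_zero {x : ZMod (p ^ 2)} (h : reduceModSq p x ≠ 0) : IsUnit x := by
  obtain ⟨n, rfl⟩ := ZMod.intCast_surjective x
  refine isUnit_intCast_zmod_sq fun hd => h ?_
  rwa [map_intCast, ZMod.intCast_zmod_eq_zero_iff_dvd]

lemma reduceModSq_ne_zero_of_isUnit {x : ZMod (p ^ 2)} (h : IsUnit x) : reduceModSq p x ≠ 0 :=
  (h.map (reduceModSq p)).ne_zero

lemma reduceModSq_pow_card (x : ZMod (p ^ 2)) : reduceModSq p (x ^ p) = reduceModSq p x := by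
  rw [map_pow, ZMod.pow_card]

/-- A Teichmüller lift of a primitive root. -/
lemma exists_reduceModSq_eq_and_pow_eq_one (g : ZMod p) (hg : g ≠ 0) :
    ∃ τ : ZMod (p ^ 2), reduceModSq p τ = g ∧ τ ^ (p - 1) = 1 := by
  obtain ⟨n, rfl⟩ := ZMod.intCast_surjective g
  have hn : reduceModSq p (n : ZMod (p ^ 2)) = n := map_intCast _ _
  refine ⟨(n : ZMod (p ^ 2)) ^ p, by rw [reduceModSq_pow_card, hn], ?_⟩
  rw [← pow_mul, mul_comm, pow_mul]
  refine (pow_eq_pow_of_reduceModSq_eq (y := 1) ?_).trans (one_pow p)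
  rw [map_pow, hn, ZMod.pow_card_sub_one_eq_one hg, map_one]

lemma quadraticChar_reduceModSq (hm : p = 6 * m + 1) (x : ZMod (p ^ 2)) :
    (quadraticChar (ZMod p) (reduceModSq p x) : ZMod (p ^ 2)) = x ^ (3 * m * p) := by
  have hp1 := hp.out.one_lt
  have h1 := quadraticChar_eq_pow_of_char_ne_two' (F := ZMod p)
    (by rw [ZMod.ringChar_zmod_n]; lia) (reduceModSq p x)
  rw [ZMod.card, show p / 2 = 3 * m by lia] at h1
  rw [pow_mul]
  have h2 : (quadraticChar (ZMod p) (reduceModSq p x) : ZMod (p ^ 2)) =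
      (quadraticChar (ZMod p) (reduceModSq p x) : ZMod (p ^ 2)) ^ p := by
    have hodd : Odd p := ⟨3 * m, by lia⟩
    rcases quadraticChar_isQuadratic (ZMod p) (reduceModSq p x) with h | h | h <;> rw [h]
    · simp [hp.out.ne_zero]
    · simp
    · simp [hodd.neg_one_pow]
  rw [h2]
  apply pow_eq_pow_of_reduceModSq_eq
  rw [map_intCast, h1, map_pow]

lemma two_mul_pow_mul_eq_sub (hm : p = 6 * m + 1) {y : ZMod (p ^ 2)} (hy : y = 0 ∨ IsUnit y) :
    2 * y ^ (3 * m * p) = 3 * y ^ (3 * m) - y ^ (9 * m) := by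
  have hp1 := hp.out.one_lt
  rcases hy with rfl | hy
  · rw [zero_pow (by simp; lia), zero_pow (by lia), zero_pow (by lia)]
    ring
  have h1 : reduceModSq p (y ^ (6 * m)) = reduceModSq p 1 := by
    rw [map_pow, map_one, show 6 * m = p - 1 by lia,
      ZMod.pow_card_sub_one_eq_one (reduceModSq_ne_zero_of_isUnit hy)]
  obtain ⟨w, hw⟩ := exists_eq_add_mul_of_reduceModSq_eq h1
  have hP := natCast_self_mul_self_zmod_sq (p := p)
  have hPm := natCast_self_zmod_sq_eq (p := p) hm
  have h2 : ∀ n : ℕ, (1 + (p : ZMod (p ^ 2)) * w) ^ n = 1 + n * ((p : ZMod (p ^ 2)) * w) := by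
    intro n
    induction n with
    | zero => simp
    | succ n ih =>
      rw [pow_succ (_ + _), ih]
      push_cast
      linear_combination n * w ^ 2 * hP
  rw [show 3 * m * p = 3 * m + 6 * m * (3 * m) by rw [hm]; ring, pow_add, pow_mul y (6 * m), hw, h2,
    show 9 * m = 3 * m + 6 * m by ring, pow_add, hw]
  push_cast
  linear_combination y ^ (3 * m) * w * hP - y ^ (3 * m) * w * (p : ZMod (p ^ 2)) * hPm

lemma sum_pow_pow_zmod_sq (hm : p = 6 * m + 1) {τ : ZMod (p ^ 2)} (h1 : τ ^ (p - 1) = 1)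
    (hτ : IsPrimitiveRoot (reduceModSq p τ) (p - 1)) (n : ℕ) :
    ∑ e ∈ range (6 * m), (τ ^ n) ^ e = if 6 * m ∣ n then (6 * m : ZMod (p ^ 2)) else 0 := by
  rw [show p - 1 = 6 * m by lia] at h1 hτ
  split_ifs with h
  · obtain ⟨k, rfl⟩ := h
    rw [pow_mul, h1]
    simp
  · have hu : IsUnit (τ ^ n - 1) := by
      apply isUnit_of_reduceModSq_ne_zero
      rw [map_sub, map_pow, map_one, sub_ne_zero, Ne, hτ.pow_eq_one_iff_dvd]
      exact h
    apply hu.mul_left_cancel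
    rw [mul_geom_sum, ← pow_mul, mul_comm, pow_mul, h1, one_pow]
    ring

lemma sum_mul_one_sub_pow_zmod_sq (hm : p = 6 * m + 1) {τ : ZMod (p ^ 2)} (h1 : τ ^ (p - 1) = 1)
    (hτ : IsPrimitiveRoot (reduceModSq p τ) (p - 1)) (n : ℕ) :
    ∑ e ∈ range (6 * m), (τ ^ (4 * m)) ^ e * (1 - τ ^ e) ^ n =
      6 * m * ∑ j ∈ range (n + 1) with 6 * m ∣ 4 * m + j, (-1) ^ j * (n.choose j : ZMod (p ^ 2)) := by
  have h : ∀ e ∈ range (6 * m), (τ ^ (4 * m)) ^ e * (1 - τ ^ e) ^ n =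
      ∑ j ∈ range (n + 1), (-1) ^ j * (n.choose j : ZMod (p ^ 2)) * (τ ^ (4 * m + j)) ^ e := by
    intro e _
    rw [show 1 - τ ^ e = -τ ^ e + 1 by ring, add_pow, mul_sum]
    refine sum_congr rfl fun j _ => ?_
    rw [neg_pow, one_pow]
    ring
  rw [sum_congr rfl h, sum_comm, sum_filter, mul_sum]
  refine sum_congr rfl fun j _ => ?_
  rw [← mul_sum, sum_pow_pow_zmod_sq hm h1 hτ]
  split_ifs <;> ring

lemma two_mul_sum_quadraticChar (hm : p = 6 * m + 1) {τ : ZMod (p ^ 2)} (h1 : τ ^ (p - 1) = 1)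
    (hτ : IsPrimitiveRoot (reduceModSq p τ) (p - 1)) :
    2 * ∑ e ∈ range (6 * m), (τ ^ (4 * m)) ^ e *
      (quadraticChar (ZMod p) (1 - reduceModSq p τ ^ e) : ZMod (p ^ 2)) =
      6 * m * (3 * ((3 * m).choose m : ZMod (p ^ 2)) -
        (((9 * m).choose m : ZMod (p ^ 2)) + (9 * m).choose (2 * m))) := by
  have hp1 := hp.out.one_lt
  have h3 := sum_mul_one_sub_pow_zmod_sq hm h1 hτ (3 * m)
  have h9 := sum_mul_one_sub_pow_zmod_sq hm h1 hτ (9 * m)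
  have hf3 : (range (3 * m + 1)).filter (fun j => 6 * m ∣ 4 * m + j) = {2 * m} := by
    ext j
    simp only [mem_filter, mem_range, mem_singleton]
    refine ⟨fun ⟨h, k, hk⟩ => ?_, fun h => ⟨by lia, 1, by lia⟩⟩
    have : k = 1 := by
      have : k < 2 := by by_contra! hc; nlinarith
      have : 0 < k := by by_contra! hc; obtain rfl : k = 0 := by lia
                         lia
      lia
    subst this
    lia
  have hf9 : (range (9 * m + 1)).filter (fun j => 6 * m ∣ 4 * m + j) = {2 * m, 8 * m} := by
    ext j
    simp only [mem_filter, mem_range, mem_singleton, mem_insert]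
    refine ⟨fun ⟨h, k, hk⟩ => ?_, fun h => ?_⟩
    · have : k < 3 := by by_contra! hc; nlinarith
      interval_cases k <;> lia
    · rcases h with rfl | rfl
      · exact ⟨by lia, 1, by ring⟩
      · exact ⟨by lia, 2, by ring⟩
  rw [hf3, sum_singleton, (even_two_mul m).neg_one_pow, one_mul,
    Nat.choose_symm_of_eq_add (show 3 * m = 2 * m + m by ring)] at h3
  rw [hf9, sum_pair (by lia), (even_two_mul m).neg_one_pow, show 8 * m = 2 * (4 * m) by ring,
    (even_two_mul (4 * m)).neg_one_pow, one_mul, one_mul,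
    Nat.choose_symm_of_eq_add (show 9 * m = 2 * (4 * m) + m by ring)] at h9
  have h : ∀ e ∈ range (6 * m), 2 * ((τ ^ (4 * m)) ^ e *
      (quadraticChar (ZMod p) (1 - reduceModSq p τ ^ e) : ZMod (p ^ 2))) =
      3 * ((τ ^ (4 * m)) ^ e * (1 - τ ^ e) ^ (3 * m)) - (τ ^ (4 * m)) ^ e * (1 - τ ^ e) ^ (9 * m) := by
    intro e he
    have hr : 1 - reduceModSq p τ ^ e = reduceModSq p (1 - τ ^ e) := by simp
    have hy : 1 - τ ^ e = 0 ∨ IsUnit (1 - τ ^ e) := by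
      rcases Nat.eq_zero_or_pos e with rfl | h0
      · left; simp
      · right
        apply isUnit_of_reduceModSq_ne_zero
        rw [← hr, sub_ne_zero, ne_comm]
        exact hτ.pow_ne_one_of_pos_of_lt h0.ne' (by rw [mem_range] at he; lia)
    rw [hr, quadraticChar_reduceModSq hm]
    linear_combination (τ ^ (4 * m)) ^ e * two_mul_pow_mul_eq_sub hm hy
  rw [mul_sum, sum_congr rfl h, sum_sub_distrib, ← mul_sum, h3, h9]
  ring

end

section

variable {p m : ℕ} [hp : Fact p.Prime]

lemma not_dvd_two_mul (hm : p = 6 * m + 1) {a b : ℤ} (hab : (p : ℤ) = a ^ 2 + 3 * b ^ 2) :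
    ¬ (p : ℤ) ∣ 2 * a := by
  have hp1 := hp.out.one_lt
  have hpi := Nat.prime_iff_prime_int.1 hp.out
  have hnat : ∀ n : ℕ, n ≠ 0 → n < p → ¬ (p : ℤ) ∣ n := fun n h0 hn h => by
    have := Nat.le_of_dvd (by lia) (Int.natCast_dvd_natCast.1 h)
    lia
  rw [hpi.dvd_mul]
  rintro (h | ⟨c, rfl⟩)
  · exact hnat 2 (by simp) (by lia) (by exact_mod_cast h)
  · have h3 : (p : ℤ) ∣ 3 * b ^ 2 := ⟨1 - p * c ^ 2, by linear_combination -hab⟩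
    rcases hpi.dvd_or_dvd h3 with h | h
    · exact hnat 3 (by simp) (by lia) (by exact_mod_cast h)
    · obtain ⟨d, rfl⟩ := hpi.dvd_of_dvd_pow h
      have : (p : ℤ) * (p * (c ^ 2 + 3 * d ^ 2)) = p * 1 := by linear_combination -hab
      have := mul_left_cancel₀ hpi.ne_zero this
      exact hpi.not_isUnit (IsUnit.of_mul_eq_one _ this)

lemma sum_hyperNum_mul_inv_hyperDen (hm : p = 6 * m + 1) {a b : ℤ}
    (hab : (p : ℤ) = a ^ 2 + 3 * b ^ 2) (ha : a % 3 = 1) :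
    ∑ k ∈ range p, (hyperNum k 0 : ZMod (p ^ 2)) * (hyperDen k 0 : ZMod (p ^ 2))⁻¹ =
      ((2 * a : ℤ) : ZMod (p ^ 2)) -
        (p : ZMod (p ^ 2)) * ((2 * a : ℤ) : ZMod (p ^ 2))⁻¹ := by
  have hp1 := hp.out.one_lt
  have hS := two_mul_sum_hyperNum_mul_inv_hyperDen hm
  obtain ⟨g, hg⟩ := exists_isPrimitiveRoot_zmod p
  obtain ⟨τ, rfl, hτ⟩ := exists_reduceModSq_eq_and_pow_eq_one g (hg.ne_zero (by lia))
  have hJ := two_mul_sum_quadraticChar hm hτ hg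
  have hz3 : (τ ^ (4 * m)) ^ 3 = 1 := by
    rw [← pow_mul, show 4 * m * 3 = (p - 1) * 2 by lia, pow_mul, hτ, one_pow]
  have hz : (τ ^ (4 * m)) ^ 2 + τ ^ (4 * m) + 1 = 0 := by
    have hu : IsUnit (τ ^ (4 * m) - 1) := by
      apply isUnit_of_reduceModSq_ne_zero
      rw [map_sub, map_pow, map_one, sub_ne_zero, Ne, hg.pow_eq_one_iff_dvd]
      rintro ⟨k, hk⟩
      rw [show p - 1 = 6 * m by lia] at hk
      have : k < 1 := by by_contra! hc; nlinarith
      interval_cases k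
      lia
    apply hu.mul_left_cancel
    linear_combination hz3
  rw [sum_pow_mul_quadraticChar hz3] at hJ
  have hn1 := congrArg (Int.cast : ℤ → ZMod (p ^ 2)) (two_mul_cubicClassSum_sub_sub hm hg hab ha)
  have hn2 := congrArg (Int.cast : ℤ → ZMod (p ^ 2)) (cubicClassSum_norm hm hg)
  have hP := natCast_self_mul_self_zmod_sq (p := p)
  have hPm := natCast_self_zmod_sq_eq (p := p) hm
  have hC := choose_two_thirds_add_choose_third hm
  have hH := harmonicModSq_two_add_three hm
  have hu2 := isUnit_two_zmod_sq hm
  have hu3 := isUnit_three_zmod_sq hm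
  have hua := ZMod.mul_inv_of_unit _ (isUnit_intCast_zmod_sq (not_dvd_two_mul hm hab))
  have hB : IsUnit ((3 * m).choose m : ZMod (p ^ 2)) := by
    have h := Nat.choose_mul_factorial_mul_factorial (n := 3 * m) (k := m) (by lia)
    refine isUnit_natCast_zmod_sq fun hd => ?_
    have h' : p ∣ (3 * m).factorial := h ▸ (hd.mul_right _).mul_right _
    have := hp.out.dvd_factorial.1 h'
    lia
  push_cast at hn1 hn2 hua ⊢
  generalize (cubicClassSum (reduceModSq p τ) m 0 : ZMod (p ^ 2)) = n0 at *
  generalize (cubicClassSum (reduceModSq p τ) m 1 : ZMod (p ^ 2)) = n1 at *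
  generalize (cubicClassSum (reduceModSq p τ) m 2 : ZMod (p ^ 2)) = n2 at *
  generalize τ ^ (4 * m) = z at *
  generalize ∑ k ∈ range p, (hyperNum k 0 : ZMod (p ^ 2)) * (hyperDen k 0 : ZMod (p ^ 2))⁻¹ = S at *
  generalize ((3 * m).choose m : ZMod (p ^ 2)) = B at *
  generalize ((9 * m).choose m : ZMod (p ^ 2)) + (9 * m).choose (2 * m) = C at *
  generalize harmonicModSq p m = y1 at *
  generalize harmonicModSq p (2 * m) = y2 at *
  generalize harmonicModSq p (3 * m) = y3 at *
  generalize (2 * (a : ZMod (p ^ 2)))⁻¹ = v at *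
  generalize (p : ZMod (p ^ 2)) = P at *
  generalize (m : ZMod (p ^ 2)) = M at *
  have dP : 6 * M * P = -P := by linear_combination hP - P * hPm
  obtain ⟨u, hu⟩ : ∃ u, u = -(n0 + n1 * z + n2 * z ^ 2) := ⟨_, rfl⟩
  obtain ⟨u', hu'⟩ : ∃ u', u' = -(n0 + n1 * z ^ 2 + n2 * z) := ⟨_, rfl⟩
  have h6u : 6 * u = B * (6 - P * (3 * y3 - 2 * y2 - y1)) := by
    linear_combination 6 * hu - 3 * hJ + 3 * (3 * B - C) * hPm - (1 - P) * hC
      + B * (3 * y3 - 2 * y2 - y1 - 6) * hP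
  have hadd : u + u' = 2 * a := by
    linear_combination hu + hu' - hn1 + (-n1 - n2) * hz
  have hmul : u * u' = P := by
    rw [hu, hu']
    linear_combination hn2 + (n1 ^ 2 + n2 ^ 2 + n1 * n2 * z) * hz3
      + (n0 * n1 + n1 * n2 + n0 * n2) * hz
  have huu : IsUnit u := by
    have : 6 * u * (6 + P * (3 * y3 - 2 * y2 - y1)) = B * 2 * 2 * 3 * 3 := by
      linear_combination (6 + P * (3 * y3 - 2 * y2 - y1)) * h6u
        - B * (3 * y3 - 2 * y2 - y1) ^ 2 * hP
    have h36 : IsUnit (6 * u * (6 + P * (3 * y3 - 2 * y2 - y1))) := by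
      rw [this]
      exact (((hB.mul hu2).mul hu2).mul hu3).mul hu3
    exact isUnit_of_mul_isUnit_right (isUnit_of_mul_isUnit_left h36)
  have hSu : S = u := by
    apply (hu2.mul hu3).mul_left_cancel
    linear_combination 3 * hS - h6u + B * (3 * y3 - 2 * y2 - y1) * dP + 9 * B * M * hH
  have hPu : P * v = u' := by
    apply huu.mul_left_cancel
    have hPu' : P * u' = 0 := by
      apply huu.mul_left_cancel
      linear_combination P * hmul + hP
    linear_combination P * hua + P * v * hadd - v * hPu' - hmul
  rw [hSu, hPu]
  linear_combination hadd

end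

end

/-- The case `p ≡ 1 (mod 3)` of a conjecture of Z.-W. Sun:
`∑_{k=0}^{p−1} C(2k,k)·C(4k,2k)/48^k ≡ 2a − p/(2a) (mod p²)` where `p = a² + 3b²`,
`a ≡ 1 (mod 3)`. -/
theorem padic_sun_conjecture
    (p : ℕ) [Fact p.Prime] (hp : p % 3 = 1) (a b : ℤ)
    (hab : (p : ℤ) = a ^ 2 + 3 * b ^ 2) (ha : a % 3 = 1) :
    ‖(∑ k ∈ Finset.range p,
        ((Nat.choose (2 * k) k : ℚ_[p]) * (Nat.choose (4 * k) (2 * k) : ℚ_[p]))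
          / (48 : ℚ_[p]) ^ k)
      - (2 * (a : ℚ_[p]) - (p : ℚ_[p]) / (2 * (a : ℚ_[p])))‖
      ≤ (p : ℝ) ^ (-2 : ℤ) := by
  have hpp : p.Prime := Fact.out
  obtain ⟨m, hm⟩ : ∃ m, p = 6 * m + 1 := by
    have h2 : p ≠ 2 := by lia
    have := hpp.eq_two_or_odd
    exact ⟨p / 6, by lia⟩
  have hp1 := hpp.one_lt
  have h2a := not_dvd_two_mul hm hab
  obtain ⟨z, hz, hz'⟩ := exists_padicInt_eq_sum_div (p := p) (Finset.range p)
    (fun k => hyperNum k 0) (fun k => hyperDen k 0)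
    fun k hk => not_dvd_hyperDen (by lia) (Finset.mem_range.1 hk) (dvd_zero _)
  obtain ⟨w, hw, hw'⟩ := exists_padicInt_eq_sum_div (p := p) (Finset.range 1)
    (fun _ => (p : ℤ)) (fun _ => 2 * a) fun _ _ => h2a
  have key : PadicInt.toZModPow 2 (z - (((2 * a : ℤ) : ℤ_[p]) - w)) = 0 := by
    rw [map_sub, map_sub, hz', hw', map_intCast, sum_hyperNum_mul_inv_hyperDen hm hab ha]
    simp
  have hnorm : ‖z - (((2 * a : ℤ) : ℤ_[p]) - w)‖ ≤ (p : ℝ) ^ (-(2 : ℕ) : ℤ) := by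
    rw [PadicInt.norm_le_pow_iff_mem_span_pow, ← PadicInt.ker_toZModPow, RingHom.mem_ker]
    exact key
  have heq : ((z - (((2 * a : ℤ) : ℤ_[p]) - w) : ℤ_[p]) : ℚ_[p]) = (∑ k ∈ Finset.range p,
        ((Nat.choose (2 * k) k : ℚ_[p]) * (Nat.choose (4 * k) (2 * k) : ℚ_[p]))
          / (48 : ℚ_[p]) ^ k)
      - (2 * (a : ℚ_[p]) - (p : ℚ_[p]) / (2 * (a : ℚ_[p]))) := by
    rw [PadicInt.coe_sub, PadicInt.coe_sub, PadicInt.coe_intCast, hz, hw]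
    simp [choose_mul_choose_div_pow]
  rw [← heq, ← PadicInt.norm_def]
  exact hnorm
end
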